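/- arXiv:0708.0249 — 8 statements merged into one kernel-verified Lean document; each statement's English description precedes it below -/
import Mathlib

section
/- Let X be a standard Borel space and E a Borel equivalence relation on X (i.e., E is a Borel subset of X × X). Then exactly one of the following holds: either E is Borel reducible to the equality relation on ℕ (equivalently, E has at most countably many equivalence classes), or the equality relation on ℝ is Borel reducible to E. -/
namespace Silver

open Set Filter Topology MeasureTheory

abbrev C2 := ℕ → Bool
abbrev NN := ℕ → ℕ

def Agree (m : ℕ) (x y : C2) : Prop := ∀ i < m, x i = y i

structure Config where
  c : C2 → NN
  e : ℕ → C2 → NN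

variable {X : Type*}

structure IsConfig (s : ℕ → C2) (p : NN → X) (q : NN → X × X) (n : ℕ) (γ : Config) : Prop where
  depc : ∀ x y, Agree n x y → γ.c x = γ.c y
  depe : ∀ k x y, Agree n x y → γ.e k x = γ.e k y
  edge : ∀ k < n, ∀ x, Agree k x (s k) →
    (p (γ.c (Function.update x k false)), p (γ.c (Function.update x k true))) = q (γ.e k x)

def amalg (n : ℕ) (a b : Config) (w : NN) : Config where
  c x := if x n then b.c x else a.c x
  e k x := if k = n then w else if x n then b.e k x else a.e k x

lemma amalg_isConfig {s : ℕ → C2} {p : NN → X} {q : NN → X × X} {n : ℕ} {a b : Config} {w : NN}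
    (ha : IsConfig s p q n a) (hb : IsConfig s p q n b)
    (h : (p (a.c (s n)), p (b.c (s n))) = q w) : IsConfig s p q (n+1) (amalg n a b w) := by
  constructor
  · intro x y hxy
    have h1 : Agree n x y := fun i hi => hxy i (by omega)
    have h2 := hxy n (by omega)
    simp [amalg, h2, ha.depc x y h1, hb.depc x y h1]
  · intro k x y hxy
    have h1 : Agree n x y := fun i hi => hxy i (by omega)
    have h2 := hxy n (by omega)
    simp [amalg, h2, ha.depe k x y h1, hb.depe k x y h1]
  · intro k hk x hx
    rcases Nat.lt_succ_iff_lt_or_eq.1 hk with hk | rfl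
    · have hne : n ≠ k := by omega
      have hne' : k ≠ n := by omega
      have h1 := ha.edge k hk x hx
      have h2 := hb.edge k hk x hx
      by_cases hxn : x n = true
      · simpa [amalg, Function.update_of_ne hne, hxn, hne'] using h2
      · simpa [amalg, Function.update_of_ne hne, hxn, hne'] using h1
    · have h1 : ∀ v, Agree k (Function.update x k v) (s k) := by
        intro v i hi
        rw [Function.update_of_ne (by omega)]; exact hx i hi
      simpa [amalg, ha.depc _ _ (h1 false), hb.depc _ _ (h1 true)] using h

/-- `S` is positive if for every countable set of classes, some configuration in `S` avoids it. -/
def Positive (E : X → X → Prop) (p : NN → X) (S : Set Config) : Prop :=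
  ∀ Z : Set X, Z.Countable → ∃ γ ∈ S, ∀ x, ∀ z ∈ Z, ¬ E z (p (γ.c x))

lemma Positive.amalg {E : X → X → Prop} {p : NN → X} {q : NN → X × X}
    (hq : ∀ x y, ¬ E x y → ∃ w, (x, y) = q w) {S : Set Config} (hS : Positive E p S) (n : ℕ)
    (s : ℕ → C2) :
    Positive E p {γ | ∃ a ∈ S, ∃ b ∈ S, ∃ w, (p (a.c (s n)), p (b.c (s n))) = q w ∧
      γ = amalg n a b w} := by
  intro Z hZ
  obtain ⟨a, haS, ha⟩ := hS Z hZ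
  obtain ⟨b, hbS, hb⟩ := hS (insert (p (a.c (s n))) Z) (hZ.insert _)
  obtain ⟨w, hw⟩ := hq _ _ (hb (s n) _ (mem_insert _ _))
  refine ⟨_, ⟨a, haS, b, hbS, w, hw, rfl⟩, ?_⟩
  intro x z hz
  by_cases hx : x n = true
  · simpa [Silver.amalg, hx] using hb x z (mem_insert_of_mem _ hz)
  · simpa [Silver.amalg, hx] using ha x z hz

lemma Positive.piece {E : X → X → Prop} {p : NN → X} {S : Set Config} (hS : Positive E p S)
    {K : Type} [Countable K] (key : Config → K) : ∃ k, Positive E p {γ ∈ S | key γ = k} := by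
  by_contra! h
  simp only [Positive] at h
  push Not at h
  choose Z hZ hZ' using h
  obtain ⟨γ, hγ, h⟩ := hS (⋃ k, Z k) (countable_iUnion hZ)
  obtain ⟨x, z, hz, hE⟩ := hZ' (key γ) γ ⟨hγ, rfl⟩
  exact h x z (mem_iUnion.2 ⟨_, hz⟩) hE

def ext (n : ℕ) (t : Fin n → Bool) : C2 := fun i => if h : i < n then t ⟨i, h⟩ else false

lemma agree_ext (n : ℕ) (x : C2) : Agree n x (ext n (fun i => x i)) := by
  intro i hi; simp [ext, hi]

def key (n : ℕ) (γ : Config) : ((Fin n → Bool) → Fin n → ℕ) × (Fin n → (Fin n → Bool) → Fin n → ℕ) :=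
  (fun t i => γ.c (ext n t) i, fun k t i => γ.e k (ext n t) i)

lemma key_c {s : ℕ → C2} {p : NN → X} {q : NN → X × X} {n : ℕ} {a b : Config} 
    (ha : IsConfig s p q n a) (hb : IsConfig s p q n b) (h : key n a = key n b) (x : C2) (i : ℕ)
    (hi : i < n) : a.c x i = b.c x i := by
  rw [ha.depc _ _ (agree_ext n x), hb.depc _ _ (agree_ext n x)]
  exact congrFun (congrFun (congrArg Prod.fst h) _) ⟨i, hi⟩

lemma key_e {s : ℕ → C2} {p : NN → X} {q : NN → X × X} {n : ℕ} {a b : Config} 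
    (ha : IsConfig s p q n a) (hb : IsConfig s p q n b) (h : key n a = key n b) (k : ℕ) (hk : k < n)
    (x : C2) (i : ℕ)
    (hi : i < n) : a.e k x i = b.e k x i := by
  rw [ha.depe _ _ _ (agree_ext n x), hb.depe _ _ _ (agree_ext n x)]
  exact congrFun (congrFun (congrFun (congrArg Prod.snd h) ⟨k, hk⟩) _) ⟨i, hi⟩

lemma exists_seq {E : X → X → Prop} {p : NN → X} (hp : Function.Surjective p)
    {q : NN → X × X} (hq : ∀ x y, ¬ E x y → ∃ w, (x, y) = q w) (s : ℕ → C2)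
    (hunc : ∀ Z : Set X, Z.Countable → ∃ x, ∀ z ∈ Z, ¬ E z x) :
    ∃ S : ℕ → Set Config, (∀ n, (S n).Nonempty) ∧ (∀ n, ∀ γ ∈ S n, IsConfig s p q n γ) ∧
      (∀ n, ∀ a ∈ S n, ∀ b ∈ S n, key n a = key n b) ∧
      (∀ n, ∀ γ ∈ S (n+1), ∃ a ∈ S n, ∃ b ∈ S n, ∃ w, γ = amalg n a b w) := by
  let P : ℕ → Set Config → Prop := fun n S => Positive E p S ∧ (∀ γ ∈ S, IsConfig s p q n γ) ∧
      (∀ a ∈ S, ∀ b ∈ S, key n a = key n b)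
  have h0 : P 0 {γ | IsConfig s p q 0 γ} := by
    refine ⟨?_, fun γ h => h, ?_⟩
    · intro Z hZ
      obtain ⟨x, hx⟩ := hunc Z hZ
      obtain ⟨y, rfl⟩ := hp x
      exact ⟨⟨fun _ => y, fun _ _ => y⟩, ⟨fun _ _ _ => rfl, fun _ _ _ _ => rfl,
        fun k hk => absurd hk (by omega)⟩, fun _ => hx⟩
    · intro a _ b _
      exact Prod.ext (funext fun t => funext fun i => i.elim0) (funext fun i => i.elim0)
  have hs : ∀ n S, P n S → ∃ S', P (n+1) S' ∧ ∀ γ ∈ S', ∃ a ∈ S, ∃ b ∈ S, ∃ w, γ = amalg n a b w := by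
    rintro n S ⟨h1, h2, h3⟩
    obtain ⟨k, hk⟩ := (h1.amalg hq n s).piece (key (n+1))
    refine ⟨_, ⟨hk, ?_, ?_⟩, ?_⟩
    · rintro γ ⟨⟨a, ha, b, hb, w, hw, rfl⟩, _⟩
      exact amalg_isConfig (h2 a ha) (h2 b hb) hw
    · rintro a ⟨_, ha⟩ b ⟨_, hb⟩
      exact ha.trans hb.symm
    · rintro γ ⟨⟨a, ha, b, hb, w, hw, rfl⟩, _⟩
      exact ⟨a, ha, b, hb, w, rfl⟩
  choose! F hF1 hF2 using hs
  let S : ℕ → Set Config := fun n => Nat.rec {γ | IsConfig s p q 0 γ} (fun n S => F n S) n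
  have hS : ∀ n, P n (S n) := by
    intro n
    induction n with
    | zero => exact h0
    | succ n ih => exact hF1 n _ ih
  refine ⟨S, fun n => ?_, fun n => (hS n).2.1, fun n => (hS n).2.2, fun n => hF2 n _ (hS n)⟩
  obtain ⟨γ, h, _⟩ := (hS n).1 ∅ countable_empty
  exact ⟨γ, h⟩

lemma exists_hom [TopologicalSpace X] [T2Space X] {E : X → X → Prop} (hE : Equivalence E)
    {p : NN → X} (hp : Function.Surjective p) (hpc : Continuous p)
    {q : NN → X × X} (hq : range q = {z | ¬ E z.1 z.2}) (hqc : Continuous q) (s : ℕ → C2)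
    (hunc : ∀ Z : Set X, Z.Countable → ∃ x, ∀ z ∈ Z, ¬ E z x) :
    ∃ h : C2 → X, Continuous h ∧ ∀ k x, Agree k x (s k) →
      ¬ E (h (Function.update x k false)) (h (Function.update x k true)) := by
  obtain ⟨S, hne, hcf, hkey, ham⟩ := exists_seq hp (q := q)
    (fun x y hxy => by
      have : (x, y) ∈ range q := by rw [hq]; exact hxy
      obtain ⟨w, hw⟩ := this
      exact ⟨w, hw.symm⟩) s hunc
  choose g hg using hne
  -- coherence
  have cohc : ∀ m n, m ≤ n → ∀ γ ∈ S n, ∀ x, ∀ i < m, γ.c x i = (g m).c x i := by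
    intro m n hmn
    induction n, hmn using Nat.le_induction with
    | base =>
      intro γ hγ x i hi
      exact key_c (hcf _ _ hγ) (hcf _ _ (hg m)) (hkey m _ hγ _ (hg m)) x i hi
    | succ n hmn ih =>
      intro γ hγ x i hi
      obtain ⟨a, ha, b, hb, w, rfl⟩ := ham n γ hγ
      by_cases hx : x n = true
      · simpa [amalg, hx] using ih b hb x i hi
      · simpa [amalg, hx] using ih a ha x i hi
  have cohe : ∀ m n, m ≤ n → ∀ γ ∈ S n, ∀ k < m, ∀ x, ∀ i < m, γ.e k x i = (g m).e k x i := by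
    intro m n hmn
    induction n, hmn using Nat.le_induction with
    | base =>
      intro γ hγ k hk x i hi
      exact key_e (hcf _ _ hγ) (hcf _ _ (hg m)) (hkey m _ hγ _ (hg m)) k hk x i hi
    | succ n hmn ih =>
      intro γ hγ k hk x i hi
      obtain ⟨a, ha, b, hb, w, rfl⟩ := ham n γ hγ
      have hkn : k ≠ n := by omega
      by_cases hx : x n = true
      · simpa [amalg, hx, hkn] using ih b hb k hk x i hi
      · simpa [amalg, hx, hkn] using ih a ha k hk x i hi
  let Φ : C2 → NN := fun x i => (g (i+1)).c x i
  let Ψ : ℕ → C2 → NN := fun k x i => (g (max i k + 1)).e k x i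
  have limc : ∀ x, Tendsto (fun n => (g n).c x) atTop (𝓝 (Φ x)) := by
    intro x
    rw [tendsto_pi_nhds]
    intro i
    apply tendsto_const_nhds.congr'
    filter_upwards [eventually_ge_atTop (i+1)] with n hn
    exact (cohc (i+1) n hn (g n) (hg n) x i (by omega)).symm
  have lime : ∀ k x, Tendsto (fun n => (g n).e k x) atTop (𝓝 (Ψ k x)) := by
    intro k x
    rw [tendsto_pi_nhds]
    intro i
    apply tendsto_const_nhds.congr'
    filter_upwards [eventually_ge_atTop (max i k+1)] with n hn
    exact (cohe (max i k+1) n hn (g n) (hg n) k (by omega) x i (by omega)).symm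
  have hΦ : Continuous Φ := by
    refine continuous_pi fun i => ?_
    have : (fun x => Φ x i) = (fun t : Fin (i+1) → Bool => (g (i+1)).c (ext (i+1) t) i) ∘
        (fun x : C2 => fun j : Fin (i+1) => x j) := by
      funext x
      simp only [Φ, Function.comp]
      rw [(hcf _ _ (hg (i+1))).depc _ _ (agree_ext (i+1) x)]
    rw [this]
    exact continuous_of_discreteTopology.comp (by fun_prop)
  refine ⟨p ∘ Φ, hpc.comp hΦ, ?_⟩
  intro k x hx
  have h1 : Tendsto (fun n => (p ((g n).c (Function.update x k false)),
      p ((g n).c (Function.update x k true)))) atTop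
      (𝓝 (p (Φ (Function.update x k false)), p (Φ (Function.update x k true)))) :=
    ((hpc.tendsto _).comp (limc _)).prodMk_nhds ((hpc.tendsto _).comp (limc _))
  have h2 : Tendsto (fun n => q ((g n).e k x)) atTop (𝓝 (q (Ψ k x))) :=
    (hqc.tendsto _).comp (lime k x)
  have h3 := tendsto_nhds_unique (h2.congr' (by
    filter_upwards [eventually_gt_atTop k] with n hn
    exact ((hcf _ _ (hg n)).edge k hn x hx).symm)) h1
  have h4 : q (Ψ k x) ∈ {z | ¬ E z.1 z.2} := by rw [← hq]; exact mem_range_self _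
  rw [h3] at h4
  exact h4

lemma isOpen_agree (m : ℕ) (x : C2) : IsOpen {y : C2 | Agree m y x} := by
  have : {y : C2 | Agree m y x} = ⋂ i ∈ Set.Iio m, {y | y i = x i} := by
    ext y; simp [Agree]
  rw [this]
  exact (Set.finite_Iio m).isOpen_biInter fun i _ =>
    (isOpen_discrete ({x i} : Set Bool)).preimage (f := fun y : C2 => y i) (continuous_apply i)

lemma exists_dense_s : ∃ s : ℕ → C2, ∀ x m, ∃ k ≥ m, Agree m (s k) x := by
  refine ⟨fun k => TopologicalSpace.denseSeq C2 k.unpair.1, fun x m => ?_⟩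
  have ho := isOpen_agree m x
  obtain ⟨j, hj⟩ := (TopologicalSpace.denseRange_denseSeq C2).exists_mem_open ho ⟨x, fun _ _ => rfl⟩
  exact ⟨Nat.pair j m, Nat.right_le_pair _ _, by simpa using hj⟩

lemma exists_agree_subset {U : Set C2} (hU : IsOpen U) {x : C2} (hx : x ∈ U) :
    ∃ m, ∀ y, Agree m y x → y ∈ U := by
  obtain ⟨I, u, hI, hu⟩ := isOpen_pi_iff.1 hU x hx
  refine ⟨I.sup id + 1, fun y hy => hu ?_⟩
  intro i hi
  rw [hy i (Nat.lt_succ_of_le (Finset.le_sup (f := id) hi))]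
  exact (hI i hi).2

lemma meagre_of_hom {F : C2 → C2 → Prop} (hF : Equivalence F)
    (hB : MeasurableSet {z : C2 × C2 | F z.1 z.2}) (s : ℕ → C2)
    (hs : ∀ x m, ∃ k ≥ m, Agree m (s k) x)
    (hne : ∀ k x, Agree k x (s k) → ¬ F (Function.update x k false) (Function.update x k true)) :
    {z : C2 × C2 | ¬ F z.1 z.2} ∈ residual (C2 × C2) := by
  have hB' : BaireMeasurableSet {z : C2 × C2 | F z.1 z.2} := hB.baireMeasurableSet
  obtain ⟨U, hU, hEU⟩ := hB'.residualEq_isOpen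
  have hR : {z : C2 × C2 | F z.1 z.2 ↔ z ∈ U} ∈ residual (C2 × C2) := by
    filter_upwards [hEU] with z hz
    exact iff_of_eq hz
  rcases U.eq_empty_or_nonempty with rfl | ⟨⟨x, y⟩, hxy⟩
  · filter_upwards [hR] with z hz
    simpa using hz
  exfalso
  obtain ⟨U1, U2, hU1, hU2, hx1, hy2, hsub⟩ := isOpen_prod_iff.1 hU x y hxy
  obtain ⟨m, hm⟩ := exists_agree_subset hU1 hx1
  obtain ⟨k, hk, hkx⟩ := hs x m
  let t : C2 → C2 := fun z => Function.update z k (!(z k))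
  have htc : Continuous t := by
    apply Continuous.update continuous_id
    exact (continuous_of_discreteTopology (f := Bool.not)).comp (f := fun z : C2 => z k) (continuous_apply k)
  have htt : Function.Involutive t := by intro z; simp [t]
  let T : (C2 × C2) ≃ₜ (C2 × C2) :=
    (Homeomorph.mk ⟨t, t, htt, htt⟩ htc htc).prodCongr (Homeomorph.refl _)
  have hR' := tendsto_residual_of_isOpenMap T.continuous T.isOpenMap hR
  have hd := dense_of_mem_residual (inter_mem hR hR')
  obtain ⟨⟨x', y'⟩, ⟨h1, h2⟩, h3⟩ := hd.inter_open_nonempty _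
    ((isOpen_agree k (s k)).prod hU2) ⟨(s k, y), fun _ _ => rfl, hy2⟩
  have key : ∀ z, Agree k z (s k) → (z, y') ∈ U := fun z hz =>
    hsub ⟨hm z fun i hi => (hz i (by omega)).trans (hkx i hi), h2⟩
  have hA : Agree k (t x') (s k) := by
    intro i hi
    simp only [t]
    rw [Function.update_of_ne (by omega)]
    exact h1 i hi
  have e1 : F x' y' := h3.1.2 (key x' h1)
  have e2 : F (t x') y' := (show F (t x') y' ↔ (t x', y') ∈ U from h3.2).2 (key _ hA)
  have e3 := hF.trans e1 (hF.symm e2)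
  apply hne k x' h1
  cases hb : x' k with
  | false =>
    have a1 : Function.update x' k false = x' := by rw [← hb]; simp
    have a2 : t x' = Function.update x' k true := by simp [t, hb]
    rw [a1, ← a2]; exact e3
  | true =>
    have a1 : Function.update x' k true = x' := by rw [← hb]; simp
    have a2 : t x' = Function.update x' k false := by simp [t, hb]
    rw [a1, ← a2]; exact hF.symm e3

lemma modulus {Y : Type*} [MetricSpace Y] (f : C(C2, Y)) {ε : ℝ} (hε : 0 < ε) :
    ∃ m, ∀ x y, Agree m x y → dist (f x) (f y) < ε := by
  have h : ∀ x, ∃ m, ∀ y, Agree m y x → dist (f y) (f x) < ε / 2 := fun x =>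
    exists_agree_subset (U := {y | dist (f y) (f x) < ε / 2})
      (isOpen_lt (by fun_prop) continuous_const) (by simpa using hε)
  choose m hm using h
  obtain ⟨I, hI⟩ := CompactSpace.elim_nhds_subcover (fun x => {y | Agree (m x) y x})
    (fun x => (isOpen_agree (m x) x).mem_nhds fun _ _ => rfl)
  refine ⟨I.sup m, fun x y hxy => ?_⟩
  have hx : x ∈ ⋃ z ∈ I, {y | Agree (m z) y z} := by rw [hI]; trivial
  simp only [mem_iUnion, exists_prop] at hx
  obtain ⟨z, hz, hxz⟩ := hx
  have hyz : Agree (m z) y z := fun i hi =>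
    (hxy i (hi.trans_le (Finset.le_sup hz))).symm.trans (hxz i hi)
  have := dist_triangle_right (f x) (f y) (f z)
  linarith [hm z x hxz, hm z y hyz]

lemma dense_tuples {Y : Type*} [MetricSpace Y] [CompleteSpace Y] {ι : Type} [Fintype ι]
    {W : Set (Y × Y)} (hW : IsOpen W) (hd : Dense W) :
    Dense {z : ι → Y | ∀ s t, s ≠ t → (z s, z t) ∈ W} := by
  classical
  have : {z : ι → Y | ∀ s t, s ≠ t → (z s, z t) ∈ W} =
      ⋂ a : {a : ι × ι // a.1 ≠ a.2}, {z : ι → Y | (z a.1.1, z a.1.2) ∈ W} := by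
    ext z; simp
  rw [this]
  apply dense_iInter_of_isOpen
  · intro a
    exact hW.preimage (f := fun z : ι → Y => (z a.1.1, z a.1.2)) (by fun_prop)
  · rintro ⟨⟨s, t⟩, hst⟩
    refine hd.preimage (f := fun z : ι → Y => (z s, z t)) ?_
    apply IsOpenMap.of_sections
    intro z
    refine ⟨fun w => Function.update (Function.update z s w.1) t w.2, ?_, ?_, ?_⟩
    · apply Continuous.continuousAt
      exact Continuous.update (Continuous.update (continuous_const (y := z)) s continuous_fst) t continuous_snd
    · simp
    · intro w
      have : s ≠ t := hst
      simp [Function.update_of_ne this]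

lemma mycielski_step {Y : Type*} [MetricSpace Y] [CompleteSpace Y]
    {W : Set (Y × Y)} (hW : IsOpen W) (hd : Dense W) (k : ℕ) :
    IsOpen {f : C(C2, Y) | ∀ x y, x k ≠ y k → (f x, f y) ∈ W} ∧
    Dense {f : C(C2, Y) | ∀ x y, x k ≠ y k → (f x, f y) ∈ W} := by
  constructor
  · have : {f : C(C2, Y) | ∀ x y, x k ≠ y k → (f x, f y) ∈ W}ᶜ =
        Prod.fst '' {z : C(C2, Y) × (C2 × C2) | z.2.1 k ≠ z.2.2 k ∧ (z.1 z.2.1, z.1 z.2.2) ∈ Wᶜ} := by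
      ext f; simp
    rw [← isClosed_compl_iff, this]
    apply isClosedMap_fst_of_compactSpace
    apply IsClosed.inter
    · exact (isClosed_discrete {b : Bool × Bool | b.1 ≠ b.2}).preimage
        (f := fun z : C(C2, Y) × (C2 × C2) => (z.2.1 k, z.2.2 k)) (by fun_prop)
    · exact hW.isClosed_compl.preimage
        (f := fun z : C(C2, Y) × (C2 × C2) => (z.1 z.2.1, z.1 z.2.2)) (by fun_prop)
  · rw [Metric.dense_iff]
    intro f ε hε
    obtain ⟨m, hm⟩ := modulus f (half_pos hε)
    let n := max m (k+1)
    obtain ⟨z, hz, hzd⟩ := (dense_tuples (ι := Fin n → Bool) hW hd).exists_dist_lt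
      (fun t => f (ext n t)) (half_pos hε)
    let g : C(C2, Y) := ⟨fun x => z (fun i => x i), by
      have : Continuous (fun x : C2 => fun i : Fin n => x i) := by fun_prop
      exact continuous_of_discreteTopology.comp this⟩
    refine ⟨g, ?_, ?_⟩
    · rw [Metric.mem_ball, dist_comm, ContinuousMap.dist_lt_iff hε]
      intro x
      have h1 := hm x (ext n (fun i => x i)) fun i hi => agree_ext n x i (by omega)
      have h2 := (dist_le_pi_dist (fun t => f (ext n t)) z (fun i => x i)).trans_lt hzd
      have h3 := dist_triangle (f x) (f (ext n (fun i => x i))) (g x)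
      have h4 : g x = z (fun i => x i) := rfl
      rw [h4] at h3 ⊢
      linarith
    · intro x y hxy
      apply hz
      intro h
      exact hxy (congrFun h ⟨k, by omega⟩)

lemma mycielski {Y : Type*} [MetricSpace Y] [CompleteSpace Y] [Nonempty Y] {R : Set (Y × Y)}
    (hR : R ∈ residual (Y × Y)) : ∃ f : C(C2, Y), ∀ x y, x ≠ y → (f x, f y) ∈ R := by
  obtain ⟨S, h1, h2, h3, h4⟩ := mem_residual_iff.1 hR
  have := h3.to_subtype
  have hd : Dense (⋂ a : S × ℕ, {f : C(C2, Y) | ∀ x y, x a.2 ≠ y a.2 → (f x, f y) ∈ a.1.1}) :=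
    dense_iInter_of_isOpen
      (fun a => (mycielski_step (h1 _ a.1.2) (h2 _ a.1.2) a.2).1)
      (fun a => (mycielski_step (h1 _ a.1.2) (h2 _ a.1.2) a.2).2)
  have : Nonempty C(C2, Y) := ⟨ContinuousMap.const _ (Classical.arbitrary Y)⟩
  obtain ⟨f, hf⟩ := hd.nonempty
  refine ⟨f, fun x y hxy => h4 ?_⟩
  obtain ⟨k, hk⟩ := Function.ne_iff.1 hxy
  intro W hW
  exact mem_iInter.1 hf (⟨W, hW⟩, k) x y hk

lemma mycielski_C2 {R : Set (C2 × C2)}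
    (hR : R ∈ residual (C2 × C2)) : ∃ f : C(C2, C2), ∀ x y, x ≠ y → (f x, f y) ∈ R := by
  let _ := TopologicalSpace.metrizableSpaceMetric C2
  have : CompleteSpace C2 := complete_of_compact
  exact mycielski hR

end Silver

open Set Filter Topology MeasureTheory in
/-- Silver's dichotomy: for a Borel equivalence relation `E` on a standard Borel
space `X`, exactly one of the following holds: `E` is Borel reducible to equality
on `ℕ`, or equality on `ℝ` is Borel reducible to `E`. -/
theorem silver_dichotomy {X : Type*} [MeasurableSpace X] [StandardBorelSpace X]
    (E : X → X → Prop) (hEquiv : Equivalence E)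
    (hBorel : MeasurableSet {p : X × X | E p.1 p.2}) :
    Xor'
      (∃ f : X → ℕ, Measurable f ∧ ∀ x y : X, E x y ↔ f x = f y)
      (∃ g : ℝ → X, Measurable g ∧ ∀ x y : ℝ, x = y ↔ E (g x) (g y)) := by
  have hexcl : ¬ ((∃ f : X → ℕ, Measurable f ∧ ∀ x y : X, E x y ↔ f x = f y) ∧
      (∃ g : ℝ → X, Measurable g ∧ ∀ x y : ℝ, x = y ↔ E (g x) (g y))) := by
    rintro ⟨⟨f, -, hf⟩, g, -, hg⟩
    have hinj : Function.Injective (f ∘ g) := fun x y h => (hg x y).2 ((hf _ _).2 h)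
    exact not_countable_iff.2 (inferInstance : Uncountable ℝ) hinj.countable
  suffices h : (∃ f : X → ℕ, Measurable f ∧ ∀ x y : X, E x y ↔ f x = f y) ∨
      (∃ g : ℝ → X, Measurable g ∧ ∀ x y : ℝ, x = y ↔ E (g x) (g y)) by
    unfold Xor'; rw [xor_iff_or_and_not_and]; exact ⟨h, hexcl⟩
  by_cases hc : ∃ Z : Set X, Z.Countable ∧ ∀ x, ∃ z ∈ Z, E z x
  · left
    obtain ⟨Z, hZ, hcov⟩ := hc
    let st : Setoid X := ⟨E, hEquiv⟩
    have := hZ.to_subtype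
    have hcount : Countable (Quotient st) := by
      have hs : Function.Surjective (fun z : Z => (Quotient.mk st z.1)) := by
        intro a
        induction a using Quotient.inductionOn with
        | h x =>
          obtain ⟨z, hz, h⟩ := hcov x
          exact ⟨⟨z, hz⟩, Quotient.sound h⟩
      exact hs.countable
    obtain ⟨e, he⟩ := exists_injective_nat (Quotient st)
    have hiff : ∀ x y : X, E x y ↔ e (Quotient.mk st x) = e (Quotient.mk st y) := fun x y =>
      ⟨fun h => congrArg e (Quotient.sound h), fun h => Quotient.exact (he h)⟩
    refine ⟨fun x => e (Quotient.mk st x), measurable_to_countable fun x => ?_, hiff⟩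
    have : (fun x => e (Quotient.mk st x)) ⁻¹' {e (Quotient.mk st x)} =
        (fun y => (y, x)) ⁻¹' {p : X × X | E p.1 p.2} := by
      ext y; simp [hiff]
    rw [this]
    exact measurable_prodMk_right hBorel
  · right
    push Not at hc
    let _ := upgradeStandardBorel X
    obtain ⟨x0, -⟩ := hc ∅ countable_empty
    obtain ⟨x1, hx1⟩ := hc {x0} (countable_singleton _)
    have hX : AnalyticSet (univ : Set X) := MeasurableSet.univ.analyticSet
    have hG : AnalyticSet {z : X × X | ¬ E z.1 z.2} := hBorel.compl.analyticSet
    rw [AnalyticSet] at hX hG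
    obtain ⟨p, hpc, hp⟩ := hX.resolve_left (Set.Nonempty.ne_empty ⟨x0, trivial⟩)
    obtain ⟨q, hqc, hq⟩ := hG.resolve_left (Set.Nonempty.ne_empty ⟨(x0, x1), hx1 _ rfl⟩)
    obtain ⟨s, hs⟩ := Silver.exists_dense_s
    obtain ⟨h, hhc, hh⟩ := Silver.exists_hom hEquiv (range_eq_univ.1 hp) hpc hq hqc s hc
    have hm : MeasurableSet {z : Silver.C2 × Silver.C2 | E (h z.1) (h z.2)} :=
      ((hhc.measurable.comp measurable_fst).prodMk (hhc.measurable.comp measurable_snd)) hBorel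
    obtain ⟨f, hf⟩ := Silver.mycielski_C2 (Silver.meagre_of_hom (F := fun x y => E (h x) (h y))
      ⟨fun _ => hEquiv.refl _, hEquiv.symm, hEquiv.trans⟩ hm s hs hh)
    have e : ℝ ≃ᵐ Silver.C2 := PolishSpace.measurableEquivNatBoolOfNotCountable
      (not_countable_iff.2 (inferInstance : Uncountable ℝ))
    refine ⟨fun x => h (f (e x)), hhc.measurable.comp (f.continuous.measurable.comp e.measurable), ?_⟩
    intro x y
    constructor
    · rintro rfl; exact hEquiv.refl _
    · intro hE
      by_contra hne
      exact hf (e x) (e y) (fun h => hne (e.injective h)) hE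
end

section
/- Let X be a Polish space and E a Borel equivalence relation on X with uncountably many equivalence classes. Then there is a continuous injection φ from the Cantor space 2^ℕ (= ℕ → Bool with the product topology) into X such that for all a ≠ b in 2^ℕ, φ(a) and φ(b) are E-inequivalent. -/
open Set Filter Topology

namespace SilverAux

lemma cyl_subset {U : Set (ℕ → Bool)} (hU : IsOpen U) {x : ℕ → Bool} (hx : x ∈ U) :
    ∃ m : ℕ, ∀ y : ℕ → Bool, (∀ i < m, y i = x i) → y ∈ U := by
  obtain ⟨I, u, hu, hsub⟩ := isOpen_pi_iff.1 hU x hx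
  refine ⟨I.sup id + 1, fun y hy => hsub ?_⟩
  intro i hi
  have h1 : i ≤ I.sup id := Finset.le_sup (f := id) hi
  rw [hy i (by omega)]
  exact (hu i hi).2

lemma isOpen_cyl (x : ℕ → Bool) (m : ℕ) : IsOpen {y : ℕ → Bool | ∀ i < m, y i = x i} := by
  have : {y : ℕ → Bool | ∀ i < m, y i = x i} = ⋂ i ∈ Finset.range m, {y | y i = x i} := by
    ext y; simp
  rw [this]
  refine isOpen_biInter_finset fun i _ => ?_
  have hc : Continuous (fun y : ℕ → Bool => y i) := continuous_apply i
  exact (isOpen_discrete ({x i} : Set Bool)).preimage hc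

lemma cyl2_subset {U : Set ((ℕ → Bool) × (ℕ → Bool))} (hU : IsOpen U) {x y : ℕ → Bool}
    (hx : (x, y) ∈ U) :
    ∃ m : ℕ, ∀ u v : ℕ → Bool, (∀ i < m, u i = x i) → (∀ i < m, v i = y i) → (u, v) ∈ U := by
  obtain ⟨V, W, hV, hW, hxV, hyW, hsub⟩ := isOpen_prod_iff.1 hU x y hx
  obtain ⟨m, hm⟩ := cyl_subset hV hxV
  obtain ⟨k, hk⟩ := cyl_subset hW hyW
  refine ⟨max m k, fun u v hu hv => hsub ⟨hm u fun i hi => hu i (by omega),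
    hk v fun i hi => hv i (by omega)⟩⟩

lemma step {ι : Type} [Finite ι] (x : ι → ℕ → Bool) (m : ℕ)
    {O : Set ((ℕ → Bool) × (ℕ → Bool))} (hO : IsOpen O) (hd : Dense O) :
    ∃ (y : ι → ℕ → Bool) (m' : ℕ), m + 1 ≤ m' ∧ (∀ i, ∀ k < m, y i k = x i k) ∧
      ∀ i j, i ≠ j → ∀ u v : ℕ → Bool, (∀ k < m', u k = y i k) → (∀ k < m', v k = y j k) →
        (u, v) ∈ O := by
  classical
  have hD : Dense (⋂ i, ⋂ j, {y : ι → ℕ → Bool | i ≠ j → (y i, y j) ∈ O}) := by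
    apply dense_of_mem_residual
    refine countable_iInter_mem.2 fun i => countable_iInter_mem.2 fun j => ?_
    by_cases hij : i = j
    · simp [hij]
    · have hc : Continuous (fun y : ι → ℕ → Bool => (y i, y j)) := by fun_prop
      have ho : IsOpenMap (fun y : ι → ℕ → Bool => (y i, y j)) := by
        apply IsOpenMap.of_sections
        intro y
        refine ⟨fun p => Function.update (Function.update y i p.1) j p.2, ?_, ?_, ?_⟩
        · apply Continuous.continuousAt
          have h1 : Continuous (fun p : (ℕ → Bool) × (ℕ → Bool) => Function.update y i p.1) :=
            continuous_const.update i continuous_fst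
          exact h1.update j continuous_snd
        · simp
        · intro p
          simp [Function.update_of_ne hij]
      have : {y : ι → ℕ → Bool | i ≠ j → (y i, y j) ∈ O} =
          (fun y : ι → ℕ → Bool => (y i, y j)) ⁻¹' O := by
        ext y; simp [hij]
      rw [this]
      exact residual_of_dense_open (hO.preimage hc) (hd.preimage ho)
  have hV : IsOpen {y : ι → ℕ → Bool | ∀ i, ∀ k < m, y i k = x i k} := by
    have : {y : ι → ℕ → Bool | ∀ i, ∀ k < m, y i k = x i k} =
      ⋂ i, (fun y : ι → ℕ → Bool => y i) ⁻¹' {z | ∀ k < m, z k = x i k} := by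
      ext y; simp
    rw [this]
    exact isOpen_iInter_of_finite fun i => (isOpen_cyl (x i) m).preimage (continuous_apply i)
  obtain ⟨y, hyV, hyD⟩ := hD.inter_open_nonempty _ hV ⟨x, by simp⟩
  simp only [mem_iInter, mem_ofPred_eq] at hyD hyV
  have key : ∀ i j, ∃ M : ℕ, i ≠ j → ∀ u v : ℕ → Bool, (∀ k < M, u k = y i k) →
      (∀ k < M, v k = y j k) → (u, v) ∈ O := by
    intro i j
    by_cases hij : i = j
    · exact ⟨0, fun h => absurd hij h⟩
    · obtain ⟨M, hM⟩ := cyl2_subset hO (hyD i j hij)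
      exact ⟨M, fun _ => hM⟩
  choose M hM using key
  cases nonempty_fintype ι
  refine ⟨y, (m + 1) + ∑ i, ∑ j, M i j, by omega, hyV, ?_⟩
  intro i j hij u v hu hv
  have h1 : M i j ≤ ∑ j, M i j := Finset.single_le_sum (f := fun j => M i j) (fun _ _ => Nat.zero_le _) (Finset.mem_univ j)
  have h2 : ∑ j, M i j ≤ ∑ i, ∑ j, M i j := Finset.single_le_sum (f := fun i => ∑ j, M i j) (fun _ _ => Nat.zero_le _) (Finset.mem_univ i)
  exact hM i j hij u v (fun k hk => hu k (by omega)) (fun k hk => hv k (by omega))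

/-- restriction to the first `n` bits -/
def res (n : ℕ) (a : ℕ → Bool) : Fin n → Bool := fun i => a i

lemma limit_exists {Z : Type} [TopologicalSpace Z] [DiscreteTopology Z]
    (N : ℕ)
    (γ : ∀ n, (Fin n → Bool) → ℕ → Z) 
    (h : ∀ n, N ≤ n → ∀ s : Fin (n+1) → Bool, ∀ m < n, γ (n+1) s m = γ n (Fin.init s) m) :
    ∃ f : (ℕ → Bool) → ℕ → Z, Continuous f ∧ 
      ∀ n, N ≤ n → ∀ a, ∀ m < n, f a m = γ n (res n a) m := by
  refine ⟨fun a m => γ (max N (m+1)) (res (max N (m+1)) a) m, ?_, ?_⟩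
  · refine continuous_pi fun m => ?_
    have h1 : Continuous (res (max N (m+1))) := continuous_pi fun i => continuous_apply _
    have h2 : Continuous (fun s : Fin (max N (m+1)) → Bool => γ _ s m) :=
      continuous_of_discreteTopology
    exact h2.comp h1
  · intro n hn a m hm
    have : max N (m+1) ≤ n := by omega
    induction n, this using Nat.le_induction with
    | base => rfl
    | succ n hle ih =>
      rw [h n (by omega) _ m (by omega), ih (by omega) (by omega)]
      rfl

lemma mycielski {R : Set ((ℕ → Bool) × (ℕ → Bool))} (hR : R ∈ residual _) :
    ∃ f : (ℕ → Bool) → (ℕ → Bool), Continuous f ∧ ∀ a b, a ≠ b → (f a, f b) ∈ R := by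
  obtain ⟨t, htR, htG, htd⟩ := mem_residual.1 hR
  obtain ⟨O, hO, rfl⟩ := htG.eq_iInter_nat
  let O' : ℕ → Set ((ℕ → Bool) × (ℕ → Bool)) := fun n => ⋂ i ∈ Finset.range (n+1), O i
  have hO' : ∀ n, IsOpen (O' n) := fun n => isOpen_biInter_finset fun i _ => hO i
  have hd' : ∀ n, Dense (O' n) := fun n => htd.mono fun p hp => by
    simp only [O', mem_iInter] at hp ⊢
    exact fun i _ => hp i
  let T : ℕ → Type := fun n => ((Fin n → Bool) → ℕ → Bool) × ℕ
  have hstep : ∀ n (c : T n), ∃ c' : T (n+1), c.2 + 1 ≤ c'.2 ∧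
      (∀ s, ∀ k < c.2, c'.1 s k = c.1 (Fin.init s) k) ∧
      ∀ s t, s ≠ t → ∀ u v : ℕ → Bool, (∀ k < c'.2, u k = c'.1 s k) →
        (∀ k < c'.2, v k = c'.1 t k) → (u, v) ∈ O' n := by
    intro n c
    obtain ⟨y, m', h1, h2, h3⟩ := step (fun s : Fin (n+1) → Bool => c.1 (Fin.init s)) c.2 (hO' n) (hd' n)
    exact ⟨(y, m'), h1, h2, h3⟩
  choose nxt hn1 hn2 hn3 using hstep
  let c : ∀ n, T n := fun n => Nat.rec (motive := T) (fun _ _ => false, 0) nxt n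
  have hc : ∀ n, c (n+1) = nxt n (c n) := fun n => rfl
  have hlen : ∀ n, n ≤ (c n).2 := by
    intro n
    induction n with
    | zero => omega
    | succ n ih => have := hn1 n (c n); rw [← hc] at this; omega
  obtain ⟨f, hf, hfc⟩ := limit_exists 0 (fun n => (c n).1) (by
    intro n _ s m hm
    have := hn2 n (c n) s m (lt_of_lt_of_le hm (hlen n))
    rwa [← hc] at this)
  have hcoh : ∀ a n j, n ≤ j → ∀ m < (c n).2, (c j).1 (res j a) m = (c n).1 (res n a) m := by
    intro a n j hj
    induction j, hj using Nat.le_induction with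
    | base => intros; rfl
    | succ j hle ih =>
      intro m hm
      have hmono : (c n).2 ≤ (c j).2 := by
        clear ih
        induction j, hle using Nat.le_induction with
        | base => rfl
        | succ j _ ih => have := hn1 j (c j); rw [← hc] at this; omega
      rw [hc, hn2 j (c j) _ m (by omega)]
      exact ih m hm
  have hf2 : ∀ a n, ∀ m < (c n).2, f a m = (c n).1 (res n a) m := by
    intro a n m hm
    rw [hfc (max n (m+1)) (by omega) a m (by omega)]
    exact hcoh a n _ (by omega) m hm
  refine ⟨f, hf, fun a b hab => htR ?_⟩
  obtain ⟨k, hk⟩ := Function.ne_iff.1 hab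
  rw [mem_iInter]
  intro i
  have : (f a, f b) ∈ O' (max i k) := by
    refine hn3 (max i k) (c _) (res _ a) (res _ b) ?_ _ _ ?_ ?_
    · intro h
      exact hk (congrFun h ⟨k, by omega⟩)
    · rw [← hc]; exact hf2 a (max i k + 1)
    · rw [← hc]; exact hf2 b (max i k + 1)
  simp only [O', mem_iInter] at this
  exact this i (by simp)

lemma exists_seq : ∃ S : ℕ → ℕ → Bool, ∀ U : Set (ℕ → Bool), IsOpen U → U.Nonempty →
    ∃ k, ∀ y : ℕ → Bool, (∀ i < k, y i = S k i) → y ∈ U := by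
  obtain ⟨d, hd⟩ := TopologicalSpace.exists_dense_seq (ℕ → Bool)
  refine ⟨fun k => d k.unpair.1, fun U hU hne => ?_⟩
  obtain ⟨_, hx, ⟨i, rfl⟩⟩ := hd.inter_open_nonempty U hU hne
  obtain ⟨m, hm⟩ := cyl_subset hU hx
  refine ⟨Nat.pair i m, fun y hy => hm y fun j hj => ?_⟩
  have := hy j (lt_of_lt_of_le hj (Nat.right_le_pair i m))
  simpa using this

lemma meager {E' : (ℕ → Bool) → (ℕ → Bool) → Prop} (hE : Equivalence E')
    (hB : MeasurableSet {p : (ℕ → Bool) × (ℕ → Bool) | E' p.1 p.2})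
    {S : ℕ → ℕ → Bool} (hS : ∀ U : Set (ℕ → Bool), IsOpen U → U.Nonempty →
      ∃ k, ∀ y : ℕ → Bool, (∀ i < k, y i = S k i) → y ∈ U)
    (hG : ∀ (k : ℕ) (a b : ℕ → Bool), a k = false → b k = true → (∀ i, i ≠ k → a i = b i) →
      (∀ i < k, a i = S k i) → ¬ E' a b) :
    {p : (ℕ → Bool) × (ℕ → Bool) | ¬ E' p.1 p.2} ∈ residual _ := by
  obtain ⟨U, hU, hEU⟩ := hB.residualEq_isOpen
  have hEU' : {p : (ℕ → Bool) × (ℕ → Bool) | E' p.1 p.2 ↔ p ∈ U} ∈ residual _ := by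
    filter_upwards [hEU] with p hp
    exact iff_of_eq hp
  rcases U.eq_empty_or_nonempty with rfl | ⟨⟨x₀, y₀⟩, hne⟩
  · filter_upwards [hEU'] with p hp
    simpa using hp
  exfalso
  obtain ⟨V, W, hV, hW, hxV, hyW, hsub⟩ := isOpen_prod_iff.1 hU x₀ y₀ hne
  obtain ⟨k, hk⟩ := hS V hV ⟨_, hxV⟩
  let fl : (ℕ → Bool) → (ℕ → Bool) := fun a => Function.update a k (!(a k))
  have hnot : Continuous (fun b : Bool => !b) := continuous_of_discreteTopology
  have hev : Continuous (fun a : ℕ → Bool => !(a k)) := hnot.comp (continuous_apply k)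
  have hflc : Continuous fl := continuous_id.update k hev
  have hfl2 : ∀ a, fl (fl a) = a := by intro a; simp [fl]
  let F : ((ℕ → Bool) × (ℕ → Bool)) ≃ₜ ((ℕ → Bool) × (ℕ → Bool)) :=
    { toFun := fun p => (fl p.1, p.2)
      invFun := fun p => (fl p.1, p.2)
      left_inv := fun p => by simp [hfl2]
      right_inv := fun p => by simp [hfl2]
      continuous_toFun := by fun_prop
      continuous_invFun := by fun_prop }
  have h2 := tendsto_residual_of_isOpenMap F.continuous F.isOpenMap hEU'
  have hdense := dense_of_mem_residual (inter_mem hEU' h2)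
  obtain ⟨⟨x, y⟩, ⟨hx, hy⟩, hp1, hp2⟩ := hdense.inter_open_nonempty
    ({x : ℕ → Bool | ∀ i < k, x i = S k i} ×ˢ W) ((isOpen_cyl (S k) k).prod hW)
    ⟨(S k, y₀), by simp, hyW⟩
  simp only [mem_ofPred_eq] at hx hy
  have hflx : ∀ i < k, fl x i = S k i := fun i hi => by
    simp only [fl]; rw [Function.update_of_ne (by omega)]; exact hx i hi
  have e1 : E' x y := hp1.2 (hsub ⟨hk x hx, hy⟩)
  have e2 : E' (fl x) y := hp2.2 (hsub ⟨hk _ hflx, hy⟩)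
  have e3 : E' x (fl x) := hE.trans e1 (hE.symm e2)
  have hne' : ∀ i, i ≠ k → fl x i = x i := fun i hi => Function.update_of_ne hi _ _
  have hk' : fl x k = !(x k) := Function.update_self _ _ _
  cases hxk : x k with
  | false => exact hG k x (fl x) hxk (by simp [hk', hxk]) (fun i hi => (hne' i hi).symm) hx e3
  | true => exact hG k (fl x) x (by simp [hk', hxk]) hxk hne' hflx (hE.symm e3)

/-- configurations -/
structure Cfg (Z : Type) (n : ℕ) where
  g : (Fin n → Bool) → ℕ → Z
  d : ℕ → (Fin n → Bool) → ℕ → Z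

/-- finite information -/
def Cfg.r {n : ℕ} (c : Cfg ℕ n) :
    ((Fin n → Bool) → Fin n → ℕ) × (Fin n → (Fin n → Bool) → Fin n → ℕ) :=
  (fun s i => c.g s i, fun k s i => c.d k s i)

/-- validity -/
def Cfg.Valid {X : Type*} (π : (ℕ → ℕ) → X) (ψ : (ℕ → ℕ) → X × X) (S : ℕ → ℕ → Bool) (Y : Set X)
    {n : ℕ} (c : Cfg ℕ n) : Prop :=
  (∀ s, π (c.g s) ∈ Y) ∧
  ∀ (k : Fin n) (s t : Fin n → Bool), s k = false → t k = true → (∀ i, i ≠ k → s i = t i) →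
    (∀ i, i < k → s i = S k i) → ψ (c.d k s) = (π (c.g s), π (c.g t))

lemma Cfg.Valid.mono {X : Type*} {π : (ℕ → ℕ) → X} {ψ : (ℕ → ℕ) → X × X} {S : ℕ → ℕ → Bool}
    {Y Y' : Set X} (h : Y ⊆ Y') {n : ℕ} {c : Cfg ℕ n} (hc : c.Valid π ψ S Y) :
    c.Valid π ψ S Y' := ⟨fun s => h (hc.1 s), hc.2⟩

/-- the set `A(p, Y)` -/
def ASet {X : Type*} (π : (ℕ → ℕ) → X) (ψ : (ℕ → ℕ) → X × X) (S : ℕ → ℕ → Bool) (Y : Set X)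
    (n : ℕ) (p : ((Fin n → Bool) → Fin n → ℕ) × (Fin n → (Fin n → Bool) → Fin n → ℕ)) : Set X :=
  {x | ∃ c : Cfg ℕ n, c.Valid π ψ S Y ∧ c.r = p ∧ x = π (c.g (res n (S n)))}

lemma exists_Y {X : Type*} {Q : Type*} (q : X → Q)
    (π : (ℕ → ℕ) → X) (ψ : (ℕ → ℕ) → X × X) (S : ℕ → ℕ → Bool) :
    ∃ Y : Set X, (q '' Yᶜ).Countable ∧ ∀ n (c : Cfg ℕ n), c.Valid π ψ S Y →
      ¬ (q '' (ASet π ψ S Y n c.r)).Countable := by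
  classical
  have key : ∀ P : (Σ n : ℕ, ((Fin n → Bool) → Fin n → ℕ) × (Fin n → (Fin n → Bool) → Fin n → ℕ)),
      ∃ B : Set X, (q '' B).Countable ∧ ∀ Y : Set X, (q '' Yᶜ).Countable → Y ∩ B = ∅ →
        (q '' (ASet π ψ S Y P.1 P.2)).Countable → ASet π ψ S Y P.1 P.2 = ∅ := by
    intro P
    by_cases h : ∃ Y : Set X, (q '' Yᶜ).Countable ∧ (q '' (ASet π ψ S Y P.1 P.2)).Countable
    · obtain ⟨Y, h1, h2⟩ := h
      refine ⟨Yᶜ ∪ ASet π ψ S Y P.1 P.2, ?_, ?_⟩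
      · rw [image_union]; exact h1.union h2
      · intro Y' _ hB _
        rw [eq_empty_iff_forall_notMem]
        rintro x ⟨c, hc, hr, hx⟩
        have hsub : Y' ⊆ Y := by
          intro z hz
          by_contra hzY
          exact (eq_empty_iff_forall_notMem.1 hB z) ⟨hz, Or.inl hzY⟩
        refine (eq_empty_iff_forall_notMem.1 hB x) ⟨hx ▸ hc.1 _, Or.inr ⟨c, hc.mono hsub, hr, hx⟩⟩
    · exact ⟨∅, by simp, fun Y h1 _ h2 => absurd ⟨Y, h1, h2⟩ h⟩
  choose B hB1 hB2 using key
  have hco : (q '' ((⋃ P, B P)ᶜ)ᶜ).Countable := by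
    rw [compl_compl, image_iUnion]
    exact countable_iUnion hB1
  refine ⟨(⋃ P, B P)ᶜ, hco, ?_⟩
  intro n c hc hcount
  have := hB2 ⟨n, c.r⟩ _ hco (by
    rw [eq_empty_iff_forall_notMem]
    rintro x ⟨h1, h2⟩
    exact h1 (mem_iUnion.2 ⟨_, h2⟩)) hcount
  exact (eq_empty_iff_forall_notMem.1 this) _ ⟨c, hc, rfl, rfl⟩

/-- gluing -/
def glue {n : ℕ} (c0 c1 : Cfg ℕ n) (w : ℕ → ℕ) : Cfg ℕ (n+1) where
  g := fun s => if s (Fin.last n) then c1.g (Fin.init s) else c0.g (Fin.init s)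
  d := fun k s => if k = n then w else
    if s (Fin.last n) then c1.d k (Fin.init s) else c0.d k (Fin.init s)

lemma glue_valid {X : Type*} {π : (ℕ → ℕ) → X} {ψ : (ℕ → ℕ) → X × X} {S : ℕ → ℕ → Bool}
    {Y : Set X} {n : ℕ} {c0 c1 : Cfg ℕ n} {w : ℕ → ℕ}
    (h0 : c0.Valid π ψ S Y) (h1 : c1.Valid π ψ S Y)
    (hw : ψ w = (π (c0.g (res n (S n))), π (c1.g (res n (S n))))) :
    (glue c0 c1 w).Valid π ψ S Y := by
  refine ⟨fun s => ?_, fun k s t hs ht hst hS => ?_⟩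
  · simp only [glue]
    split_ifs
    · exact h1.1 _
    · exact h0.1 _
  · induction k using Fin.lastCases with
    | last =>
      have e1 : Fin.init s = res n (S n) := by
        funext i
        exact hS i.castSucc (Fin.castSucc_lt_last i)
      have e2 : Fin.init t = res n (S n) := by
        rw [← e1]
        funext i
        exact (hst i.castSucc (Fin.castSucc_lt_last i).ne).symm
      simp [glue, hs, ht, e1, e2, hw]
    | cast k =>
      have hl : s (Fin.last n) = t (Fin.last n) := hst _ (Fin.castSucc_lt_last k).ne'
      have hk : (k : ℕ) ≠ n := k.2.ne
      have a1 : ∀ i, i ≠ k → Fin.init s i = Fin.init t i := fun i hi =>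
        hst i.castSucc (fun h => hi (Fin.castSucc_injective _ h))
      have a2 : ∀ i, i < k → Fin.init s i = S k i := fun i hi => hS i.castSucc hi
      cases hb : t (Fin.last n) with
      | false =>
        simp only [glue, hl, hb, Fin.val_castSucc, hk, if_false]
        exact h0.2 k _ _ hs ht a1 a2
      | true =>
        simp only [glue, hl, hb, Fin.val_castSucc, hk, if_false, if_true]
        exact h1.2 k _ _ hs ht a1 a2

lemma exists_hom {X : Type*} [TopologicalSpace X] [T2Space X]
    (E : X → X → Prop) (hEquiv : Equivalence E)
    (hUnc : ¬ Countable (Quotient (⟨E, hEquiv⟩ : Setoid X)))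
    {π : (ℕ → ℕ) → X} (hπ : Continuous π) (hπs : Function.Surjective π)
    {ψ : (ℕ → ℕ) → X × X} (hψ : Continuous ψ) (hψr : range ψ = {p : X × X | ¬ E p.1 p.2})
    (S : ℕ → ℕ → Bool) :
    ∃ f : (ℕ → Bool) → X, Continuous f ∧
      ∀ (k : ℕ) (a b : ℕ → Bool), a k = false → b k = true → (∀ i, i ≠ k → a i = b i) →
      (∀ i < k, a i = S k i) → ¬ E (f a) (f b) := by
  let q : X → Quotient (⟨E, hEquiv⟩ : Setoid X) := Quotient.mk _
  have hq : ∀ x y, q x = q y ↔ E x y := fun x y => Quotient.eq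
  obtain ⟨Y, hY, hA⟩ := exists_Y q π ψ S
  have hYne : Y.Nonempty := by
    by_contra h
    rw [not_nonempty_iff_eq_empty] at h
    subst h
    rw [compl_empty, image_univ, Quotient.mk_surjective.range_eq] at hY
    exact hUnc (countable_univ_iff.1 hY)
  obtain ⟨y, hy⟩ := hYne
  obtain ⟨z, rfl⟩ := hπs y
  let T : ℕ → Type := fun n => {c : Cfg ℕ n // c.Valid π ψ S Y}
  have hstep : ∀ n (c : T n), ∃ c' : T (n+1), 
      (∀ s, ∀ m < n, c'.1.g s m = c.1.g (Fin.init s) m) ∧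
      (∀ k < n, ∀ s, ∀ m < n, c'.1.d k s m = c.1.d k (Fin.init s) m) := by
    rintro n ⟨c, hc⟩
    have h1 := hA n c hc
    have h2 : ¬ (q '' (ASet π ψ S Y n c.r)).Subsingleton := fun h => h1 h.countable
    rw [not_subsingleton_iff] at h2
    obtain ⟨_, ⟨x, ⟨c0, hc0, hr0, rfl⟩, rfl⟩, _, ⟨y, ⟨c1, hc1, hr1, rfl⟩, rfl⟩, hne⟩ := h2
    have hw : (π (c0.g (res n (S n))), π (c1.g (res n (S n)))) ∈ range ψ := by
      rw [hψr]
      exact fun h => hne ((hq _ _).2 h)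
    obtain ⟨w, hw⟩ := hw
    have g0 : ∀ s, ∀ m < n, c0.g s m = c.g s m := fun s m hm =>
      congrFun (congrFun (congrArg Prod.fst hr0) s) ⟨m, hm⟩
    have g1 : ∀ s, ∀ m < n, c1.g s m = c.g s m := fun s m hm =>
      congrFun (congrFun (congrArg Prod.fst hr1) s) ⟨m, hm⟩
    have d0 : ∀ k < n, ∀ s, ∀ m < n, c0.d k s m = c.d k s m := fun k hk s m hm =>
      congrFun (congrFun (congrFun (congrArg Prod.snd hr0) ⟨k, hk⟩) s) ⟨m, hm⟩
    have d1 : ∀ k < n, ∀ s, ∀ m < n, c1.d k s m = c.d k s m := fun k hk s m hm =>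
      congrFun (congrFun (congrFun (congrArg Prod.snd hr1) ⟨k, hk⟩) s) ⟨m, hm⟩
    refine ⟨⟨glue c0 c1 w, glue_valid hc0 hc1 hw⟩, ?_, ?_⟩
    · intro s m hm
      simp only [glue]
      split_ifs
      · exact g1 _ m hm
      · exact g0 _ m hm
    · intro k hk s m hm
      simp only [glue, hk.ne, if_false]
      split_ifs
      · exact d1 k hk _ m hm
      · exact d0 k hk _ m hm
  choose nxt hn1 hn2 using hstep
  let c : ∀ n, T n := fun n => Nat.rec (motive := T)
    ⟨⟨fun _ => z, fun _ _ => z⟩, fun _ => hy, fun k => k.elim0⟩ nxt n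
  obtain ⟨f, hf, hfc⟩ := limit_exists 0 (fun n => (c n).1.g) (fun n _ s m hm => hn1 n (c n) s m hm)
  have hlim : ∀ (N : ℕ) (F : (ℕ → Bool) → ℕ → ℕ) (γ : ∀ n, (Fin n → Bool) → ℕ → ℕ),
      (∀ n, N ≤ n → ∀ a, ∀ m < n, F a m = γ n (res n a) m) → ∀ a,
      Tendsto (fun n => γ n (res n a)) atTop (𝓝 (F a)) := by
    intro N F γ h a
    rw [tendsto_pi_nhds]
    intro m
    refine tendsto_const_nhds.congr' ?_
    filter_upwards [eventually_ge_atTop (max N (m+1))] with n hn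
    exact h n (by omega) a m (by omega)
  refine ⟨fun a => π (f a), hπ.comp hf, ?_⟩
  intro k a b hak hbk hab haS
  obtain ⟨e, he, hec⟩ := limit_exists (k+1) (fun n => (c n).1.d k)
    (fun n hn s m hm => hn2 n (c n) k (by omega) s m hm)
  have t1 := (hπ.tendsto _).comp (hlim 0 f _ hfc a)
  have t2 := (hπ.tendsto _).comp (hlim 0 f _ hfc b)
  have t3 := (hψ.tendsto _).comp (hlim (k+1) e _ hec a)
  have heq : ψ (e a) = (π (f a), π (f b)) := by
    refine tendsto_nhds_unique t3 ((t1.prodMk_nhds t2).congr' ?_)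
    filter_upwards [eventually_ge_atTop (k+1)] with n hn
    refine ((c n).2.2 ⟨k, by omega⟩ (res n a) (res n b) hak hbk ?_ ?_).symm
    · intro i hi
      exact hab i (fun h => hi (Fin.ext h))
    · intro i hi
      exact haS i hi
  have : ψ (e a) ∈ {p : X × X | ¬ E p.1 p.2} := hψr ▸ mem_range_self _
  rw [heq] at this
  exact this

end SilverAux

/-- Perfect set version of Silver's theorem: if a Borel equivalence relation `E`
on a Polish space `X` has uncountably many classes, then there is a continuous
injection of the Cantor space into `X` whose values are pairwise `E`-inequivalent. -/
theorem cantor_injection_of_uncountably_many_classes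
    {X : Type*} [TopologicalSpace X] [PolishSpace X]
    [MeasurableSpace X] [BorelSpace X]
    (E : X → X → Prop) (hEquiv : Equivalence E)
    (hBorel : MeasurableSet {p : X × X | E p.1 p.2})
    (hUnc : ¬ Countable (Quotient (⟨E, hEquiv⟩ : Setoid X))) :
    ∃ φ : (ℕ → Bool) → X, Continuous φ ∧ Function.Injective φ ∧
      ∀ a b : ℕ → Bool, a ≠ b → ¬ E (φ a) (φ b) := by
  have hXne : Nonempty X := by
    by_contra h
    rw [not_nonempty_iff] at h
    exact hUnc (by infer_instance)
  obtain ⟨π, hπ, hπs⟩ := PolishSpace.exists_nat_nat_continuous_surjective X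
  have han : MeasureTheory.AnalyticSet {p : X × X | ¬ E p.1 p.2} := hBorel.compl.analyticSet
  rw [MeasureTheory.AnalyticSet] at han
  rcases han with han | ⟨ψ, hψ, hψr⟩
  · exfalso
    apply hUnc
    have : Subsingleton (Quotient (⟨E, hEquiv⟩ : Setoid X)) := by
      refine ⟨fun x y => ?_⟩
      induction x using Quotient.inductionOn with | _ x => ?_
      induction y using Quotient.inductionOn with | _ y => ?_
      apply Quotient.sound
      by_contra h
      exact (eq_empty_iff_forall_notMem.1 han (x, y)) h
    infer_instance
  obtain ⟨S, hS⟩ := SilverAux.exists_seq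
  obtain ⟨f, hf, hfG⟩ := SilverAux.exists_hom E hEquiv hUnc hπ hπs hψ hψr S
  have hB : MeasurableSet {p : (ℕ → Bool) × (ℕ → Bool) | E (f p.1) (f p.2)} := by
    have hc : Continuous (fun p : (ℕ → Bool) × (ℕ → Bool) => (f p.1, f p.2)) := by fun_prop
    exact hc.measurable hBorel
  have hres := SilverAux.meager (E' := fun a b => E (f a) (f b))
    ⟨fun a => hEquiv.refl _, fun h => hEquiv.symm h, fun h h' => hEquiv.trans h h'⟩ hB hS hfG
  obtain ⟨g, hg, hgR⟩ := SilverAux.mycielski hres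
  refine ⟨fun a => f (g a), hf.comp hg, ?_, fun a b hab => hgR a b hab⟩
  intro a b hab
  by_contra hne
  have h : f (g a) = f (g b) := hab
  exact hgR a b hne (by simp only [h]; exact hEquiv.refl _)
end

section
/- (Harrington–Kechris–Louveau dichotomy) Let X be a standard Borel space and E a Borel equivalence relation on X. Then either E is Borel reducible to the equality relation on ℝ, or E₀ is Borel reducible to E. -/
/-- The equivalence relation `E₀` on Cantor space: eventual agreement. -/
def E0 (a b : ℕ → Bool) : Prop := {n : ℕ | a n ≠ b n}.Finite

open Set Filter Topology MeasureTheory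

set_option linter.unusedSectionVars false

namespace HKL

section Analytic

variable {X : Type*} [TopologicalSpace X] [PolishSpace X] [MeasurableSpace X] [BorelSpace X]

/-- Neighbours of `A` under the relation `R`. -/
def nbr (R : Set (X × X)) (A : Set X) : Set X := {y | ∃ x ∈ A, (x, y) ∈ R}

lemma analytic_inter {Y : Type*} [TopologicalSpace Y] [T2Space Y] {s t : Set Y}
    (hs : AnalyticSet s) (ht : AnalyticSet t) : AnalyticSet (s ∩ t) := by
  have := AnalyticSet.iInter (ι := Bool) (s := fun b => if b then s else t)
    (by intro b; cases b <;> simpa)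
  rw [inter_eq_iInter]
  convert this using 2
  funext b
  cases b <;> rfl

lemma analytic_nbr {R : Set (X × X)} (hR : MeasurableSet R) {A : Set X} (hA : AnalyticSet A) :
    AnalyticSet (nbr R A) := by
  have h1 : AnalyticSet (Prod.fst ⁻¹' A : Set (X × X)) := hA.preimage continuous_fst
  have h2 : AnalyticSet ((Prod.fst ⁻¹' A : Set (X × X)) ∩ R) := analytic_inter h1 hR.analyticSet
  convert h2.image_of_continuous continuous_snd using 1
  ext y
  simp [nbr]

lemma exists_indep {R : Set (X × X)} (hR : MeasurableSet R) (hsymm : ∀ x y, (x, y) ∈ R → (y, x) ∈ R)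
    {A : Set X} (hA : AnalyticSet A) (hind : ∀ x ∈ A, ∀ y ∈ A, (x, y) ∉ R) :
    ∃ B, A ⊆ B ∧ MeasurableSet B ∧ ∀ x ∈ B, ∀ y ∈ B, (x, y) ∉ R := by
  obtain ⟨B, hAB, hdB, hB⟩ := hA.measurablySeparable (analytic_nbr hR hA) (by
    rw [Set.disjoint_left]
    rintro y hy ⟨x, hx, hxy⟩
    exact hind x hx y hy hxy)
  obtain ⟨C, hAC, hdC, hC⟩ := hA.measurablySeparable (analytic_nbr hR hB.analyticSet) (by
    rw [Set.disjoint_left]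
    rintro y hy ⟨x, hx, hxy⟩
    exact Set.disjoint_left.1 hdB ⟨y, hy, hsymm _ _ hxy⟩ hx)
  refine ⟨B ∩ C, subset_inter hAB hAC, hB.inter hC, ?_⟩
  intro x hx y hy hxy
  exact Set.disjoint_left.1 hdC ⟨x, hx.1, hxy⟩ hy.2

lemma exists_inv_sep {E : X → X → Prop} (hE : Equivalence E)
    (hB : MeasurableSet {p : X × X | E p.1 p.2}) {A C : Set X} (hA : AnalyticSet A)
    (hC : AnalyticSet C) (hAC : ∀ a ∈ A, ∀ c ∈ C, ¬ E a c) :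
    ∃ B, MeasurableSet B ∧ A ⊆ B ∧ Disjoint B C ∧ ∀ x y, E x y → (x ∈ B ↔ y ∈ B) := by
  set R : Set (X × X) := {p : X × X | E p.1 p.2} with hR
  have step : ∀ S : Set X, AnalyticSet S → Disjoint S (nbr R C) →
      ∃ T, MeasurableSet T ∧ nbr R S ⊆ T ∧ Disjoint T (nbr R C) := by
    intro S hS hd
    obtain ⟨T, h1, h2, h3⟩ := (analytic_nbr hB hS).measurablySeparable (analytic_nbr hB hC) (by
      rw [Set.disjoint_left]
      rintro y ⟨x, hx, hxy⟩ ⟨c, hc, hcy⟩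
      exact Set.disjoint_left.1 hd hx ⟨c, hc, hE.trans hcy (hE.symm hxy)⟩)
    exact ⟨T, h3, h1, h2.symm⟩
  obtain ⟨T0, hT0, hAT0, hdT0⟩ := step A hA (by
    rw [Set.disjoint_left]
    rintro y hy ⟨c, hc, hcy⟩
    exact hAC y hy c hc (hE.symm hcy))
  choose! next hn1 hn2 hn3 using fun (S : Set X) (hS : MeasurableSet S) => step S hS.analyticSet
  let T : ℕ → Set X := fun n => Nat.rec T0 (fun _ S => next S) n
  have hT : ∀ n, MeasurableSet (T n) ∧ Disjoint (T n) (nbr R C) := by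
    intro n
    induction n with
    | zero => exact ⟨hT0, hdT0⟩
    | succ n ih => exact ⟨hn1 _ ih.1 ih.2, hn3 _ ih.1 ih.2⟩
  have hsub : ∀ n, nbr R (T n) ⊆ T (n + 1) := fun n => hn2 _ (hT n).1 (hT n).2
  refine ⟨⋃ n, T n, MeasurableSet.iUnion fun n => (hT n).1, ?_, ?_, ?_⟩
  · intro a ha
    exact mem_iUnion.2 ⟨0, hAT0 ⟨a, ha, hE.refl a⟩⟩
  · rw [Set.disjoint_left]
    intro x hx hxC
    obtain ⟨n, hn⟩ := mem_iUnion.1 hx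
    exact Set.disjoint_left.1 (hT n).2 hn ⟨x, hxC, hE.refl x⟩
  · have key : ∀ x y, E x y → x ∈ ⋃ n, T n → y ∈ ⋃ n, T n := by
      intro x y hxy hx
      obtain ⟨n, hn⟩ := mem_iUnion.1 hx
      exact mem_iUnion.2 ⟨n + 1, hsub n ⟨x, hn, hxy⟩⟩
    exact fun x y hxy => ⟨key x y hxy, key y x (hE.symm hxy)⟩

/-- `IsData`: the countable family `A` of invariant Borel sets and the countable family `B` of
Borel sets which are independent. -/
def IsData (E : X → X → Prop) (A B : ℕ → Set X) : Prop :=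
  (∀ i, MeasurableSet (A i)) ∧ (∀ i x y, E x y → (x ∈ A i ↔ y ∈ A i)) ∧
  (∀ k, MeasurableSet (B k)) ∧
  (∀ k, ∀ x ∈ B k, ∀ y ∈ B k, (∀ i, x ∈ A i ↔ y ∈ A i) → E x y)

lemma measurableSet_F {A : ℕ → Set X} (hA : ∀ i, MeasurableSet (A i)) :
    MeasurableSet {p : X × X | ∀ i, p.1 ∈ A i ↔ p.2 ∈ A i} := by
  rw [ofPred_forall]
  refine MeasurableSet.iInter fun i => ?_
  have h1 : MeasurableSet {p : X × X | p.1 ∈ A i} := measurable_fst (hA i)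
  have h2 : MeasurableSet {p : X × X | p.2 ∈ A i} := measurable_snd (hA i)
  exact h1.iff h2

lemma smooth_of_sets {E : X → X → Prop} (C : ℕ → Set X) (hC : ∀ i, MeasurableSet (C i))
    (h : ∀ x y, E x y ↔ ∀ i, x ∈ C i ↔ y ∈ C i) :
    ∃ f : X → ℝ, Measurable f ∧ ∀ x y : X, E x y ↔ f x = f y := by
  classical
  obtain ⟨e, he⟩ := exists_measurableEmbedding_real (ℕ → Prop)
  refine ⟨fun x => e (fun i => x ∈ C i), he.measurable.comp ?_, ?_⟩
  · refine measurable_pi_lambda _ fun i => ?_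
    exact measurable_mem.2 (hC i)
  · intro x y
    rw [h, he.injective.eq_iff, funext_iff]
    simp

lemma smooth_of_cover {E : X → X → Prop} (hE : Equivalence E)
    (hB : MeasurableSet {p : X × X | E p.1 p.2}) {A B : ℕ → Set X} (hd : IsData E A B)
    (hcov : ∀ x, ∃ k, x ∈ B k) :
    ∃ f : X → ℝ, Measurable f ∧ ∀ x y : X, E x y ↔ f x = f y := by
  obtain ⟨hA, hAi, hBm, hBi⟩ := hd
  have hF := measurableSet_F hA
  have hsep : ∀ k, ∃ C, MeasurableSet C ∧ B k ⊆ C ∧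
      Disjoint C (nbr ({p : X × X | ∀ i, p.1 ∈ A i ↔ p.2 ∈ A i} \ {p : X × X | E p.1 p.2}) (B k)) ∧
      ∀ x y, E x y → (x ∈ C ↔ y ∈ C) := by
    intro k
    refine exists_inv_sep hE hB (hBm k).analyticSet
      (analytic_nbr (hF.diff hB) (hBm k).analyticSet) ?_
    rintro a ha c ⟨b, hb, hbF, hbE⟩ hac
    refine hbE (hE.trans (hBi k b hb a ha fun i => ?_) hac)
    exact (hbF i).trans (hAi i a c hac).symm
  choose C hC hBC hdC hCi using hsep
  refine smooth_of_sets (fun n => if n % 2 = 0 then A (n / 2) else C (n / 2)) ?_ ?_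
  · intro i
    split_ifs
    · exact hA _
    · exact hC _
  · intro x y
    constructor
    · intro hxy i
      split_ifs
      · exact hAi _ _ _ hxy
      · exact hCi _ _ _ hxy
    · intro h
      have h1 : ∀ i, x ∈ A i ↔ y ∈ A i := fun i => by simpa using h (2 * i)
      have h2 : ∀ i, x ∈ C i ↔ y ∈ C i := fun i => by
        have := h (2 * i + 1)
        have e1 : (2 * i + 1) / 2 = i := by omega
        have e2 : ¬ (2 * i + 1) % 2 = 0 := by omega
        simpa [e1, e2] using this
      obtain ⟨k, hk⟩ := hcov x
      by_contra hxy
      exact Set.disjoint_left.1 (hdC k) ((h2 k).1 (hBC k hk)) ⟨x, hk, h1, hxy⟩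

end Analytic

section Ideal

variable {X : Type*} [TopologicalSpace X] [PolishSpace X] [MeasurableSpace X] [BorelSpace X]
variable {W : Type*} [TopologicalSpace W] [PolishSpace W] [MeasurableSpace W] [BorelSpace W]

/-- A configuration is bad for the data `A`, `B`. -/
def Bad (A B : ℕ → Set X) (n : ℕ) (χ : List Bool → X × W) : Prop :=
  (∃ s t : List Bool, s.length = n ∧ t.length = n ∧ ∃ i, ¬ ((χ s).1 ∈ A i ↔ (χ t).1 ∈ A i)) ∨
  ∃ s : List Bool, s.length = n ∧ ∃ k, (χ s).1 ∈ B k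

/-- The ideal of small sets of configurations at level `n`. -/
def Small (E : X → X → Prop) (n : ℕ) (H : Set (List Bool → X × W)) : Prop :=
  ∃ A B : ℕ → Set X, IsData E A B ∧ ∀ χ ∈ H, Bad A B n χ

lemma small_iUnion {E : X → X → Prop} {n : ℕ} {H : ℕ → Set (List Bool → X × W)}
    (h : ∀ j, Small E n (H j)) : Small E n (⋃ j, H j) := by
  choose A B hd hbad using h
  refine ⟨fun m => A m.unpair.1 m.unpair.2, fun m => B m.unpair.1 m.unpair.2,
    ⟨fun i => (hd _).1 _, fun i => (hd _).2.1 _, fun i => (hd _).2.2.1 _, ?_⟩, ?_⟩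
  · intro k x hx y hy hF
    refine (hd _).2.2.2 _ x hx y hy fun i => ?_
    simpa using hF (Nat.pair k.unpair.1 i)
  · intro χ hχ
    obtain ⟨j, hj⟩ := mem_iUnion.1 hχ
    rcases hbad j χ hj with ⟨s, t, hs, ht, i, hi⟩ | ⟨s, hs, k, hk⟩
    · exact Or.inl ⟨s, t, hs, ht, Nat.pair j i, by simpa using hi⟩
    · exact Or.inr ⟨s, hs, Nat.pair j k, by simpa using hk⟩

lemma Small.mono {E : X → X → Prop} {n : ℕ} {H K : Set (List Bool → X × W)}
    (h : Small E n K) (hHK : H ⊆ K) : Small E n H := by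
  obtain ⟨A, B, hd, hb⟩ := h
  exact ⟨A, B, hd, fun χ hχ => hb χ (hHK hχ)⟩

lemma Small.union {E : X → X → Prop} {n : ℕ} {H K : Set (List Bool → X × W)}
    (h : Small E n H) (h' : Small E n K) : Small E n (H ∪ K) := by
  refine (small_iUnion (H := fun j => if j = 0 then H else K) fun j => ?_).mono ?_
  · split_ifs
    · exact h
    · exact h'
  · rintro χ (hχ | hχ)
    · exact mem_iUnion.2 ⟨0, by simpa using hχ⟩
    · exact mem_iUnion.2 ⟨1, by simpa using hχ⟩

lemma measurable_eval (s : List Bool) : Measurable fun χ : List Bool → X × W => (χ s).1 :=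
  measurable_fst.comp (measurable_pi_apply s)

lemma measurableSet_bad {A B : ℕ → Set X} (hA : ∀ i, MeasurableSet (A i))
    (hB : ∀ i, MeasurableSet (B i)) (n : ℕ) :
    MeasurableSet {χ : List Bool → X × W | Bad A B n χ} := by
  have h1 : ∀ s i, MeasurableSet {χ : List Bool → X × W | (χ s).1 ∈ A i} :=
    fun s i => measurable_eval s (hA i)
  have h2 : ∀ s i, MeasurableSet {χ : List Bool → X × W | (χ s).1 ∈ B i} :=
    fun s i => measurable_eval s (hB i)
  unfold Bad
  refine MeasurableSet.union (s₁ := {χ : List Bool → X × W | ∃ s t : List Bool, s.length = n ∧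
    t.length = n ∧ ∃ i, ¬ ((χ s).1 ∈ A i ↔ (χ t).1 ∈ A i)}) (s₂ := {χ : List Bool → X × W |
      ∃ s : List Bool, s.length = n ∧ ∃ k, (χ s).1 ∈ B k}) ?_ ?_
  · simp only [ofPred_exists, ofPred_and]
    refine MeasurableSet.iUnion fun s => MeasurableSet.iUnion fun t => ?_
    refine (MeasurableSet.const _).inter ((MeasurableSet.const _).inter ?_)
    exact MeasurableSet.iUnion fun i => ((h1 s i).iff (h1 t i)).compl
  · simp only [ofPred_exists, ofPred_and]
    refine MeasurableSet.iUnion fun s => ?_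
    refine (MeasurableSet.const _).inter ?_
    exact MeasurableSet.iUnion fun i => h2 s i

/-- Join two configurations. -/
def join (φ₀ φ₁ : List Bool → X × W) (w : W) : List Bool → X × W
  | [] => ((φ₀ []).1, w)
  | false :: l => φ₀ l
  | true :: l => φ₁ l

lemma join_not_bad {A B : ℕ → Set X} {n : ℕ} {φ₀ φ₁ : List Bool → X × W} {w : W}
    (h0 : ¬ Bad A B n φ₀) (h1 : ¬ Bad A B n φ₁) {s t : List Bool} (hs : s.length = n)
    (ht : t.length = n) (hF : ∀ i, (φ₀ s).1 ∈ A i ↔ (φ₁ t).1 ∈ A i) :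
    ¬ Bad A B (n + 1) (join φ₀ φ₁ w) := by
  unfold Bad at h0 h1
  push Not at h0 h1
  obtain ⟨h0a, h0b⟩ := h0
  obtain ⟨h1a, h1b⟩ := h1
  have key : ∀ u : List Bool, u.length = n + 1 → ∀ i,
      ((join φ₀ φ₁ w u).1 ∈ A i ↔ (φ₀ s).1 ∈ A i) := by
    rintro (_ | ⟨_ | _, u⟩) hu i
    · simp at hu
    · exact h0a u s (by simpa using hu) hs i
    · exact (h1a u t (by simpa using hu) ht i).trans (hF i).symm
  rintro (⟨u, v, hu, hv, i, hi⟩ | ⟨u, hu, k, hk⟩)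
  · exact hi ((key u hu i).trans (key v hv i).symm)
  · rcases u with (_ | ⟨_ | _, u⟩)
    · simp at hu
    · exact h0b u (by simpa using hu) k hk
    · exact h1b u (by simpa using hu) k hk

/-- The next level. -/
def nextH (f : W → X × X) (s t : List Bool) (H : Set (List Bool → X × W)) :
    Set (List Bool → X × W) :=
  {χ | (fun l => χ (false :: l)) ∈ H ∧ (fun l => χ (true :: l)) ∈ H ∧
    f (χ []).2 = ((χ (false :: s)).1, (χ (true :: t)).1)}

lemma measurableSet_nextH {f : W → X × X} (hf : Continuous f) (s t : List Bool)
    {H : Set (List Bool → X × W)} (hH : MeasurableSet H) : MeasurableSet (nextH f s t H) := by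
  have hm : ∀ b : Bool, Measurable fun (χ : List Bool → X × W) (l : List Bool) => χ (b :: l) :=
    fun b => measurable_pi_lambda _ fun l => measurable_pi_apply _
  refine (hm false hH).inter ((hm true hH).inter ?_)
  refine measurableSet_eq_fun (hf.measurable.comp (measurable_snd.comp (measurable_pi_apply _))) ?_
  exact (measurable_eval _).prodMk (measurable_eval _)

lemma large_core {E : X → X → Prop} {n : ℕ} {H : Set (List Bool → X × W)} (hH : MeasurableSet H)
    (hL : ¬ Small E n H) {A B : ℕ → Set X} (hd : IsData E A B) :
    MeasurableSet (H ∩ {χ | Bad A B n χ}ᶜ) ∧ ¬ Small E n (H ∩ {χ | Bad A B n χ}ᶜ) := by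
  refine ⟨hH.inter (measurableSet_bad hd.1 hd.2.2.1 n).compl, fun h => hL ?_⟩
  refine (h.union (⟨A, B, hd, fun χ hχ => hχ⟩ : Small E n {χ | Bad A B n χ})).mono ?_
  intro χ hχ
  by_cases hb : Bad A B n χ
  · exact Or.inr hb
  · exact Or.inl ⟨hχ, hb⟩

lemma IsData.cons_A {E : X → X → Prop} {A B : ℕ → Set X} (hd : IsData E A B) {C : Set X}
    (hC : MeasurableSet C) (hCi : ∀ x y, E x y → (x ∈ C ↔ y ∈ C)) :
    IsData E (fun i => Nat.casesOn i C A) B := by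
  refine ⟨?_, ?_, hd.2.2.1, ?_⟩
  · rintro (_ | i)
    · exact hC
    · exact hd.1 i
  · rintro (_ | i)
    · exact hCi
    · exact hd.2.1 i
  · intro k x hx y hy hF
    exact hd.2.2.2 k x hx y hy fun i => hF (i + 1)

lemma large_stepE {E : X → X → Prop} (hE : Equivalence E)
    (hEB : MeasurableSet {p : X × X | E p.1 p.2}) {f : W → X × X}
    (hfr : range f = {p : X × X | E p.1 p.2}) {n : ℕ} {s t : List Bool}
    (hs : s.length = n) (ht : t.length = n) {H : Set (List Bool → X × W)} (hH : MeasurableSet H)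
    (hL : ¬ Small E n H) : ¬ Small E (n + 1) (nextH f s t H) := by
  rintro ⟨A, B, hd, hbad⟩
  obtain ⟨hm, hl⟩ := large_core hH hL hd
  set K := H ∩ {χ | Bad A B n χ}ᶜ with hK
  obtain ⟨C, hC, hsC, htC, hCi⟩ := exists_inv_sep hE hEB
    (hm.analyticSet_image (measurable_eval s)) (hm.analyticSet_image (measurable_eval t)) (by
      rintro _ ⟨φ₀, h0, rfl⟩ _ ⟨φ₁, h1, rfl⟩ hEE
      obtain ⟨w, hw⟩ : ((φ₀ s).1, (φ₁ t).1) ∈ range f := by rw [hfr]; exact hEE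
      exact join_not_bad (w := w) h0.2 h1.2 hs ht (fun i => hd.2.1 i _ _ hEE)
        (hbad _ ⟨h0.1, h1.1, hw⟩))
  refine hl ⟨_, B, hd.cons_A hC hCi, fun χ hχ => Or.inl ⟨s, t, hs, ht, 0, fun h => ?_⟩⟩
  exact Set.disjoint_left.1 htC (h.1 (hsC ⟨χ, hχ, rfl⟩)) ⟨χ, hχ, rfl⟩

lemma large_stepG {E : X → X → Prop} (hE : Equivalence E)
    (hEB : MeasurableSet {p : X × X | E p.1 p.2}) {f : W → X × X}
    (hfr : range f = {p : X × X | E p.1 p.2}ᶜ) {n : ℕ} {s : List Bool}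
    (hs : s.length = n) {H : Set (List Bool → X × W)} (hH : MeasurableSet H)
    (hL : ¬ Small E n H) : ¬ Small E (n + 1) (nextH f s s H) := by
  rintro ⟨A, B, hd, hbad⟩
  obtain ⟨hm, hl⟩ := large_core hH hL hd
  set K := H ∩ {χ | Bad A B n χ}ᶜ with hK
  obtain ⟨C, hsC, hC, hCi⟩ := exists_indep ((measurableSet_F hd.1).diff hEB)
    (fun x y h => ⟨fun i => (h.1 i).symm, fun h' => h.2 (hE.symm h')⟩)
    (hm.analyticSet_image (measurable_eval s)) (by
      rintro _ ⟨φ₀, h0, rfl⟩ _ ⟨φ₁, h1, rfl⟩ ⟨hF, hEE⟩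
      obtain ⟨w, hw⟩ : ((φ₀ s).1, (φ₁ s).1) ∈ range f := by rw [hfr]; exact hEE
      exact join_not_bad (w := w) h0.2 h1.2 hs hs hF (hbad _ ⟨h0.1, h1.1, hw⟩))
  refine hl ⟨A, fun _ => C, ⟨hd.1, hd.2.1, fun _ => hC, ?_⟩, fun χ hχ =>
    Or.inr ⟨s, hs, 0, hsC ⟨χ, hχ, rfl⟩⟩⟩
  intro _ x hx y hy hF
  by_contra hxy
  exact hCi x hx y hy ⟨hF, hxy⟩

end Ideal

section Construction

variable {X : Type*} [MetricSpace X] [CompleteSpace X] [SecondCountableTopology X]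
  [MeasurableSpace X] [BorelSpace X]
variable {W : Type*} [MetricSpace W] [CompleteSpace W] [SecondCountableTopology W]
  [MeasurableSpace W] [BorelSpace W]

lemma large_nonempty {E : X → X → Prop} {n : ℕ} {H : Set (List Bool → X × W)}
    (hL : ¬ Small E n H) : H.Nonempty := by
  by_contra h
  rw [not_nonempty_iff_eq_empty] at h
  subst h
  exact hL ⟨fun _ => ∅, fun _ => ∅, ⟨by simp, by simp, by simp, by simp⟩, by simp⟩

lemma shrink1 {E : X → X → Prop} {n : ℕ} {H : Set (List Bool → X × W)} (hH : MeasurableSet H)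
    (hL : ¬ Small E n H) (l : List Bool) {ε : ℝ} (hε : 0 < ε) :
    ∃ K ⊆ H, MeasurableSet K ∧ ¬ Small E n K ∧ ∀ χ ∈ K, ∀ χ' ∈ K, dist (χ l) (χ' l) ≤ ε := by
  obtain ⟨χ₀, _⟩ := large_nonempty hL
  have : Nonempty (X × W) := ⟨χ₀ []⟩
  let d := TopologicalSpace.denseSeq (X × W)
  have hd : DenseRange d := TopologicalSpace.denseRange_denseSeq _
  by_contra! hcon
  refine hL ((small_iUnion (H := fun j => H ∩ {χ | dist (χ l) (d j) ≤ ε / 2}) fun j => ?_).mono ?_)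
  · by_contra hS
    obtain ⟨χ, hχ, χ', hχ', h⟩ := hcon _ inter_subset_left (hH.inter
      (measurableSet_le ((measurable_pi_apply l).dist measurable_const) measurable_const)) hS
    have h1 : dist (χ l) (d j) ≤ ε / 2 := hχ.2
    have h2 : dist (χ' l) (d j) ≤ ε / 2 := hχ'.2
    have := dist_triangle_right (χ l) (χ' l) (d j)
    linarith
  · intro χ hχ
    obtain ⟨j, hj⟩ := hd.exists_dist_lt (χ l) (half_pos hε)
    exact mem_iUnion.2 ⟨j, hχ, hj.le⟩

lemma shrink {E : X → X → Prop} {n : ℕ} {H : Set (List Bool → X × W)} (hH : MeasurableSet H)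
    (hL : ¬ Small E n H) {ε : ℝ} (hε : 0 < ε) (L : Set (List Bool)) (hfin : L.Finite) :
    ∃ K ⊆ H, MeasurableSet K ∧ ¬ Small E n K ∧
      ∀ l ∈ L, ∀ χ ∈ K, ∀ χ' ∈ K, dist (χ l) (χ' l) ≤ ε := by
  induction L, hfin using Set.Finite.induction_on with
  | empty => exact ⟨H, Subset.rfl, hH, hL, by simp⟩
  | @insert a L _ _ ih =>
    obtain ⟨K, hKH, hK, hKL, hKd⟩ := ih
    obtain ⟨K', hKH', hK', hKL', hKd'⟩ := shrink1 hK hKL a hε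
    refine ⟨K', hKH'.trans hKH, hK', hKL', ?_⟩
    rintro l (rfl | hl) χ hχ χ' hχ'
    · exact hKd' χ hχ χ' hχ'
    · exact hKd l hl χ (hKH' hχ) χ' (hKH' hχ')

/-- Reversed initial segment. -/
def pre (x : ℕ → Bool) : ℕ → List Bool
  | 0 => []
  | n + 1 => x n :: pre x n

/-- Reversed segment starting at `n` of length `d`. -/
def seg (x : ℕ → Bool) (n : ℕ) : ℕ → List Bool
  | 0 => []
  | d + 1 => x (n + d) :: seg x n d

lemma length_pre (x : ℕ → Bool) (n : ℕ) : (pre x n).length = n := by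
  induction n with
  | zero => rfl
  | succ n ih => simp [pre, ih]

lemma length_seg (x : ℕ → Bool) (n d : ℕ) : (seg x n d).length = d := by
  induction d with
  | zero => rfl
  | succ n ih => simp [seg, ih]

lemma pre_congr {x y : ℕ → Bool} {n : ℕ} (h : ∀ i < n, x i = y i) : pre x n = pre y n := by
  induction n with
  | zero => rfl
  | succ n ih => simp [pre, h n (by omega), ih fun i hi => h i (by omega)]

lemma seg_congr {x y : ℕ → Bool} {n : ℕ} (h : ∀ i ≥ n, x i = y i) (d : ℕ) :
    seg x n d = seg y n d := by
  induction d with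
  | zero => rfl
  | succ d ih => simp [seg, h (n + d) (by omega), ih]

lemma seg_append_pre (x : ℕ → Bool) (n d : ℕ) : seg x n d ++ pre x n = pre x (n + d) := by
  induction d with
  | zero => rfl
  | succ d ih => simp [seg, ih, pre]

theorem exists_hom {E : X → X → Prop} (hE : Equivalence E)
    (hEB : MeasurableSet {p : X × X | E p.1 p.2})
    (hns : ¬ Small E 0 (univ : Set (List Bool → X × W)))
    {fE fG : W → X × X} (hfE : Continuous fE) (hfG : Continuous fG)
    (hrE : range fE = {p : X × X | E p.1 p.2}) (hrG : range fG = {p : X × X | E p.1 p.2}ᶜ)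
    (ty : ℕ → Bool) (S T : ℕ → ℕ → Bool) (hST : ∀ n, ty n = false → S n = T n) :
    ∃ Φ : (ℕ → Bool) → X, Continuous Φ ∧ ∀ n x y, (∀ i < n, x i = S n i) → x n = false →
      (∀ i < n, y i = T n i) → y n = true → (∀ i ≥ n + 1, x i = y i) →
      (ty n = true → E (Φ x) (Φ y)) ∧ (ty n = false → ¬ E (Φ x) (Φ y)) := by
  let f : ℕ → W → X × X := fun n => if ty n then fE else fG
  have hf : ∀ n, Continuous (f n) := by
    intro n
    simp only [f]
    split_ifs <;> assumption
  let P : ℕ → Set (List Bool → X × W) → Prop := fun n H => MeasurableSet H ∧ ¬ Small E n H ∧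
    ∀ l : List Bool, l.length ≤ n → ∀ χ ∈ H, ∀ χ' ∈ H, dist (χ l) (χ' l) ≤ (1 / 2 : ℝ) ^ n
  have hinit : ∃ H, P 0 H := by
    obtain ⟨K, -, h1, h2, h3⟩ := shrink MeasurableSet.univ hns (ε := (1 / 2 : ℝ) ^ 0)
      (by positivity) _ (List.finite_length_le Bool 0)
    exact ⟨K, h1, h2, h3⟩
  have hstep : ∀ n H, P n H → ∃ K, P (n + 1) K ∧ K ⊆ nextH (f n) (pre (S n) n) (pre (T n) n) H := by
    rintro n H ⟨h1, h2, -⟩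
    have hl : ¬ Small E (n + 1) (nextH (f n) (pre (S n) n) (pre (T n) n) H) := by
      simp only [f]
      split_ifs with h
      · exact large_stepE hE hEB hrE (length_pre _ _) (length_pre _ _) h1 h2
      · rw [← hST n (by simpa using h)]
        exact large_stepG hE hEB hrG (length_pre _ _) h1 h2
    obtain ⟨K, h0, h1, h2, h3⟩ := shrink (measurableSet_nextH (hf n) _ _ h1) hl
      (ε := (1 / 2 : ℝ) ^ (n + 1)) (by positivity) _ (List.finite_length_le Bool (n + 1))
    exact ⟨K, ⟨h1, h2, h3⟩, h0⟩
  obtain ⟨H0, hH0⟩ := hinit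
  choose! next hn1 hn2 using hstep
  let H : ℕ → Set (List Bool → X × W) := fun n => Nat.rec H0 (fun n K => next n K) n
  have hP : ∀ n, P n (H n) := by
    intro n
    induction n with
    | zero => exact hH0
    | succ n ih => exact hn1 n _ ih
  have hsub : ∀ n, H (n + 1) ⊆ nextH (f n) (pre (S n) n) (pre (T n) n) (H n) :=
    fun n => hn2 n _ (hP n)
  have hdist : ∀ n (l : List Bool), l.length ≤ n → ∀ χ ∈ H n, ∀ χ' ∈ H n,
    dist (χ l) (χ' l) ≤ (1 / 2 : ℝ) ^ n := fun n => (hP n).2.2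
  choose χ hχ using fun n => large_nonempty (hP n).2.1
  clear_value H
  have hcons : ∀ n (b : Bool) φ, φ ∈ H (n + 1) → (fun l => φ (b :: l)) ∈ H n := by
    intro n b φ hφ
    cases b
    · exact (hsub n hφ).1
    · exact (hsub n hφ).2.1
  have hseg : ∀ x n d φ, φ ∈ H (n + d) → (fun l => φ (seg x n d ++ l)) ∈ H n := by
    intro x n d
    induction d with
    | zero => intro φ hφ; exact hφ
    | succ d ih => intro φ hφ; exact ih _ (hcons (n + d) (x (n + d)) φ hφ)
  -- the approximations
  let u : (ℕ → Bool) → ℕ → X := fun x n => (χ n (pre x n)).1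
  have hucauchy : ∀ x, CauchySeq (u x) := by
    intro x
    refine cauchySeq_of_le_geometric (1 / 2) 1 (by norm_num) fun n => ?_
    have := hdist n (pre x n) (length_pre x n).le _ (hχ n) _ (hcons n (x n) _ (hχ (n + 1)))
    rw [one_mul]
    exact (le_max_left _ _).trans this
  choose Φ hΦ using fun x => cauchySeq_tendsto_of_complete (hucauchy x)
  have hclose : ∀ x y n, (∀ i < n, y i = x i) → dist (Φ y) (Φ x) ≤ (1 / 2 : ℝ) ^ n := by
    intro x y n hxy
    refine le_of_tendsto ((hΦ y).dist (hΦ x)) ?_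
    filter_upwards [eventually_ge_atTop n] with m hm
    obtain ⟨d, rfl⟩ := Nat.exists_eq_add_of_le hm
    have := hdist n (pre x n) (length_pre x n).le _ (hseg y n d _ (hχ (n + d)))
      _ (hseg x n d _ (hχ (n + d)))
    rw [seg_append_pre, ← pre_congr hxy, seg_append_pre] at this
    exact (le_max_left _ _).trans this
  refine ⟨Φ, ?_, ?_⟩
  · rw [continuous_iff_continuousAt]
    intro x
    rw [ContinuousAt, Metric.tendsto_nhds]
    intro ε hε
    obtain ⟨n, hn⟩ := exists_pow_lt_of_lt_one hε (by norm_num : (1 / 2 : ℝ) < 1)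
    filter_upwards [(PiNat.isOpen_cylinder (fun _ => Bool) x n).mem_nhds
      (PiNat.self_mem_cylinder x n)] with y hy
    exact (hclose x y n hy).trans_lt hn
  · intro n x y hxS hxn hyT hyn hxy
    let v : ℕ → W := fun d => (χ (n + 1 + d) (seg x (n + 1) d)).2
    have hvc : CauchySeq v := by
      refine cauchySeq_of_le_geometric (1 / 2) 1 (by norm_num) fun d => ?_
      have := hdist (n + 1 + d) (seg x (n + 1) d) (by rw [length_seg]; omega) _ (hχ (n + 1 + d)) _
        (hcons (n + 1 + d) (x (n + 1 + d)) _ (hχ (n + 1 + d + 1)))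
      have h1 := (le_max_right _ _).trans this
      refine (h1 : dist (v d) (v (d + 1)) ≤ _).trans ?_
      rw [one_mul]
      exact pow_le_pow_of_le_one (by norm_num) (by norm_num) (by omega)
    obtain ⟨w, hw⟩ := cauchySeq_tendsto_of_complete hvc
    have hedge : ∀ d, f n (v d) = (u x (n + 1 + d), u y (n + 1 + d)) := by
      intro d
      have := (hsub n (hseg x (n + 1) d _ (hχ (n + 1 + d)))).2.2
      simp only [List.append_nil] at this
      have e1 : seg x (n + 1) d ++ false :: pre (S n) n = pre x (n + 1 + d) := by
        rw [← seg_append_pre, pre, hxn, pre_congr hxS]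
      have e2 : seg x (n + 1) d ++ true :: pre (T n) n = pre y (n + 1 + d) := by
        rw [← seg_append_pre, pre, hyn, pre_congr hyT, seg_congr hxy]
      rw [e1, e2] at this
      exact this
    have hlim : f n w = (Φ x, Φ y) := by
      have hs : Tendsto (fun d => n + 1 + d) atTop atTop :=
        tendsto_atTop_mono (fun d => Nat.le_add_left d (n + 1)) tendsto_id
      refine tendsto_nhds_unique (((hf n).tendsto w).comp hw) ?_
      have := ((hΦ x).comp hs).prodMk_nhds ((hΦ y).comp hs)
      refine this.congr fun d => (hedge d).symm
    constructor
    · intro hty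
      have : (Φ x, Φ y) ∈ range fE := ⟨w, by simpa [f, hty] using hlim⟩
      rw [hrE] at this
      exact this
    · intro hty
      have : (Φ x, Φ y) ∈ range fG := ⟨w, by simpa [f, hty] using hlim⟩
      rw [hrG] at this
      exact this

end Construction

section Category

/-- Overwrite `z` by `p` below `m`. -/
def ov (p : ℕ → Bool) (m : ℕ) (z : ℕ → Bool) : ℕ → Bool := fun j => if j < m then p j else z j

lemma ov_lt {p z : ℕ → Bool} {m j : ℕ} (h : j < m) : ov p m z j = p j := by simp [ov, h]

lemma ov_ge {p z : ℕ → Bool} {m j : ℕ} (h : m ≤ j) : ov p m z j = z j := by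
  simp [ov, Nat.not_lt.2 h]

lemma exists_cyl {U : Set (ℕ → Bool)} (hU : IsOpen U) {x : ℕ → Bool} (hx : x ∈ U) :
    ∃ k, ∀ y, (∀ i < k, y i = x i) → y ∈ U := by
  obtain ⟨_, ⟨z, k, rfl⟩, hxz, hs⟩ :=
    (PiNat.isTopologicalBasis_cylinders (fun _ => Bool)).exists_subset_of_mem_open hx hU
  exact ⟨k, fun y hy => hs fun i hi => (hy i hi).trans (hxz i hi)⟩

lemma exists_cyl₂ {U : Set ((ℕ → Bool) × (ℕ → Bool))} (hU : IsOpen U) {x y : ℕ → Bool}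
    (hx : (x, y) ∈ U) :
    ∃ k, ∀ x' y', (∀ i < k, x' i = x i) → (∀ i < k, y' i = y i) → (x', y') ∈ U := by
  obtain ⟨V, V', hV, hV', hxV, hyV, hs⟩ := isOpen_prod_iff.1 hU x y hx
  obtain ⟨k, hk⟩ := exists_cyl hV hxV
  obtain ⟨k', hk'⟩ := exists_cyl hV' hyV
  refine ⟨max k k', fun x' y' h h' => hs ⟨hk _ fun i hi => h i ?_, hk' _ fun i hi => h' i ?_⟩⟩
  · exact lt_max_of_lt_left hi
  · exact lt_max_of_lt_right hi

lemma continuous_ov (p : ℕ → Bool) (m : ℕ) : Continuous (ov p m) := by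
  refine continuous_pi fun j => ?_
  unfold ov
  split_ifs
  · exact continuous_const
  · exact continuous_apply j

lemma isOpenMap_ov (p : ℕ → Bool) (m : ℕ) : IsOpenMap (ov p m) := by
  intro V hV
  rw [isOpen_iff_mem_nhds]
  rintro _ ⟨z, hz, rfl⟩
  obtain ⟨k, hk⟩ := exists_cyl hV hz
  refine mem_of_superset ((PiNat.isOpen_cylinder (fun _ => Bool) (ov p m z) (max k m)).mem_nhds
      (PiNat.self_mem_cylinder _ _)) ?_
  intro w hw
  have hw' : ∀ i < max k m, w i = ov p m z i := hw
  refine ⟨ov z m w, hk _ fun i hi => ?_, ?_⟩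
  · by_cases him : i < m
    · rw [ov_lt him]
    · rw [ov_ge (not_lt.1 him), hw' i (lt_max_of_lt_left hi), ov_ge (not_lt.1 him)]
  · funext j
    by_cases hj : j < m
    · rw [ov_lt hj, hw' j (lt_max_of_lt_right hj), ov_lt hj]
    · rw [ov_ge (not_lt.1 hj), ov_ge (not_lt.1 hj)]

theorem exists_dense_open {R : (ℕ → Bool) → (ℕ → Bool) → Prop} (hR : Equivalence R)
    (hm : MeasurableSet {p : (ℕ → Bool) × (ℕ → Bool) | R p.1 p.2})
    (hG : ∀ (α : ℕ → Bool) (k : ℕ), ∃ n ≥ k, ∃ s : ℕ → Bool, (∀ i < k, s i = α i) ∧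
      ∀ x y : ℕ → Bool, (∀ i < n, x i = s i) → x n = false → (∀ i < n, y i = s i) → y n = true →
        (∀ i ≥ n + 1, x i = y i) → ¬ R x y) :
    ∃ D : ℕ → Set ((ℕ → Bool) × (ℕ → Bool)), (∀ n, IsOpen (D n)) ∧ (∀ n, Dense (D n)) ∧
      Antitone D ∧ ∀ x y, (∀ n, (x, y) ∈ D n) → ¬ R x y := by
  obtain ⟨U, hU, hRU⟩ := hm.residualEq_isOpen
  have hUe : U = ∅ := by
    by_contra hne
    obtain ⟨⟨x0, y0⟩, hxy⟩ := nonempty_iff_ne_empty.2 hne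
    obtain ⟨k, hk⟩ := exists_cyl₂ hU hxy
    obtain ⟨n, hnk, s, hs, hedge⟩ := hG y0 k
    let q : Bool → ℕ → Bool := fun b => ov s n (fun _ => b)
    let h : Bool → (ℕ → Bool) × (ℕ → Bool) → (ℕ → Bool) × (ℕ → Bool) :=
      fun b => Prod.map (ov x0 k) (ov (q b) (n + 1))
    have hh : ∀ b, ∀ᶠ p in residual _, h b p ∈ {p : (ℕ → Bool) × (ℕ → Bool) | R p.1 p.2} := by
      intro b
      have ht := tendsto_residual_of_isOpenMap
        ((continuous_ov x0 k).prodMap (continuous_ov (q b) (n + 1)))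
        ((isOpenMap_ov x0 k).prodMap (isOpenMap_ov (q b) (n + 1)))
      filter_upwards [ht.eventually hRU] with p hp
      have : h b p ∈ U := by
        refine hk _ _ (fun i hi => ov_lt hi) fun i hi => ?_
        rw [ov_lt (by omega), ← hs i hi]
        exact ov_lt (by omega)
      exact (iff_of_eq hp).2 this
    obtain ⟨⟨x, z⟩, h0, h1⟩ := (dense_of_mem_residual ((hh false).and (hh true))).nonempty
    refine hedge (ov (q false) (n + 1) z) (ov (q true) (n + 1) z) ?_ ?_ ?_ ?_ ?_
      (hR.trans (hR.symm h0) h1)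
    · intro i hi
      rw [ov_lt (by omega)]
      exact ov_lt hi
    · rw [ov_lt (by omega)]
      exact ov_ge le_rfl
    · intro i hi
      rw [ov_lt (by omega)]
      exact ov_lt hi
    · rw [ov_lt (by omega)]
      exact ov_ge le_rfl
    · intro i hi
      rw [ov_ge hi, ov_ge hi]
  subst hUe
  have hres : {p : (ℕ → Bool) × (ℕ → Bool) | R p.1 p.2}ᶜ ∈ residual _ := by
    filter_upwards [hRU] with p hp hpR
    exact (iff_of_eq hp).1 hpR
  obtain ⟨t, htR, htG, htd⟩ := mem_residual.1 hres
  obtain ⟨V, hV, rfl⟩ := isGδ_iff_eq_iInter_nat.1 htG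
  refine ⟨fun n => ⋂ m ∈ Set.Iic n, V m, fun n => ?_, fun n => ?_, ?_, ?_⟩
  · exact (Set.finite_Iic n).isOpen_biInter fun m _ => hV m
  · exact htd.mono fun p hp => mem_iInter₂.2 fun m _ => mem_iInter.1 hp m
  · intro a b hab p hp
    exact mem_iInter₂.2 fun m hm => mem_iInter₂.1 hp m (le_trans hm hab)
  · intro x y hxy
    exact htR (mem_iInter.2 fun n => mem_iInter₂.1 (hxy n) n (Set.mem_Iic.2 le_rfl))

lemma finite_ext {D : Set ((ℕ → Bool) × (ℕ → Bool))} (hD : IsOpen D) (hd : Dense D) (k : ℕ)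
    (Q : Set ((ℕ → Bool) × (ℕ → Bool))) (hQ : Q.Finite) :
    ∃ k' ≥ k, ∃ p₀ p₁ : ℕ → Bool, ∀ u v, (u, v) ∈ Q → ∀ x y, (∀ i < k', x i = ov u k p₀ i) →
      (∀ i < k', y i = ov v k p₁ i) → (x, y) ∈ D := by
  induction Q, hQ using Set.Finite.induction_on with
  | empty => exact ⟨k, le_rfl, fun _ => false, fun _ => false, by simp⟩
  | @insert a Q _ _ ih =>
    obtain ⟨k₁, hk₁, p₀, p₁, ih⟩ := ih
    obtain ⟨u, v⟩ := a
    obtain ⟨⟨x, y⟩, hxy, hxD⟩ := hd.inter_open_nonempty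
      (PiNat.cylinder (ov u k p₀) k₁ ×ˢ PiNat.cylinder (ov v k p₁) k₁)
      ((PiNat.isOpen_cylinder (fun _ => Bool) _ _).prod (PiNat.isOpen_cylinder (fun _ => Bool) _ _))
      ⟨(ov u k p₀, ov v k p₁), PiNat.self_mem_cylinder _ _, PiNat.self_mem_cylinder _ _⟩
    obtain ⟨k₂, hk₂⟩ := exists_cyl₂ hD hxD
    have hx : ∀ i < k₁, x i = ov u k p₀ i := hxy.1
    have hy : ∀ i < k₁, y i = ov v k p₁ i := hxy.2
    have gen : ∀ (u p x : ℕ → Bool), (∀ i < k₁, x i = ov u k p i) → ∀ u' : ℕ → Bool,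
        ∀ i < k₁, ov u' k x i = ov u' k p i := by
      intro u p x hx u' i hi
      by_cases hik : i < k
      · rw [ov_lt hik, ov_lt hik]
      · rw [ov_ge (not_lt.1 hik), ov_ge (not_lt.1 hik), hx i hi, ov_ge (not_lt.1 hik)]
    have gen' : ∀ (u p x : ℕ → Bool), (∀ i < k₁, x i = ov u k p i) → ∀ i, ov u k x i = x i := by
      intro u p x hx i
      by_cases hik : i < k
      · rw [ov_lt hik, hx i (by omega), ov_lt hik]
      · rw [ov_ge (not_lt.1 hik)]
    refine ⟨max k₁ k₂, le_max_of_le_left hk₁, x, y, ?_⟩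
    rintro u' v' (h | h) x' y' hx' hy'
    · simp only [Prod.mk.injEq] at h
      obtain ⟨rfl, rfl⟩ := h
      refine hk₂ _ _ (fun i hi => ?_) (fun i hi => ?_)
      · rw [hx' i (lt_max_of_lt_right hi), gen' _ _ _ hx]
      · rw [hy' i (lt_max_of_lt_right hi), gen' _ _ _ hy]
    · refine ih u' v' h x' y' (fun i hi => ?_) (fun i hi => ?_)
      · rw [hx' i (lt_max_of_lt_left hi), gen _ _ _ hx _ i hi]
      · rw [hy' i (lt_max_of_lt_left hi), gen _ _ _ hy _ i hi]

end Category

section Embedding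

theorem exists_embedding {R : (ℕ → Bool) → (ℕ → Bool) → Prop} (hR : Equivalence R)
    {D : ℕ → Set ((ℕ → Bool) × (ℕ → Bool))} (hDo : ∀ n, IsOpen (D n)) (hDd : ∀ n, Dense (D n))
    (hDa : Antitone D) (hDR : ∀ x y, (∀ n, (x, y) ∈ D n) → ¬ R x y)
    (hG : ∀ (α β : ℕ → Bool) (k : ℕ), ∃ n ≥ k, ∃ s t : ℕ → Bool, (∀ i < k, s i = α i) ∧
      (∀ i < k, t i = β i) ∧
      ∀ x y : ℕ → Bool, (∀ i < n, x i = s i) → x n = false → (∀ i < n, y i = t i) → y n = true →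
        (∀ i ≥ n + 1, x i = y i) → R x y) :
    ∃ ψ : (ℕ → Bool) → (ℕ → Bool), Continuous ψ ∧
      ∀ a b, {n : ℕ | a n ≠ b n}.Finite ↔ R (ψ a) (ψ b) := by
  have hstep : ∀ (n k : ℕ) (q : (ℕ → Bool) → (ℕ → Bool)), (range q).Finite →
      ∃ (k' : ℕ) (p : Bool → ℕ → Bool), k < k' ∧
      (∀ a b x y, (∀ i < k', x i = ov (q a) k (p false) i) →
        (∀ i < k', y i = ov (q b) k (p true) i) → (x, y) ∈ D n) ∧
      (∀ x y, (∀ i < k', x i = ov (q fun _ => false) k (p false) i) →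
        (∀ i < k', y i = ov (q fun _ => false) k (p true) i) → (∀ i ≥ k', x i = y i) → R x y) := by
    intro n k q hq
    obtain ⟨k₁, hk₁, p₀, p₁, hp⟩ := finite_ext (hDo n) (hDd n) k (range q ×ˢ range q) (hq.prod hq)
    obtain ⟨m, hm, s, t, hs, ht, hst⟩ := hG (ov (q fun _ => false) k p₀)
      (ov (q fun _ => false) k p₁) k₁
    have gen : ∀ (s p : ℕ → Bool) (b : Bool), (∀ i < k₁, s i = ov (q fun _ => false) k p i) →
        (∀ u : ℕ → Bool, ∀ i < k₁, ov u k (ov s m fun _ => b) i = ov u k p i) ∧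
        (∀ i < m, ov (q fun _ => false) k (ov s m fun _ => b) i = s i) ∧
        ov (q fun _ => false) k (ov s m fun _ => b) m = b := by
      intro s p b hs
      refine ⟨fun u i hi => ?_, fun i hi => ?_, ?_⟩
      · by_cases hik : i < k
        · rw [ov_lt hik, ov_lt hik]
        · rw [ov_ge (not_lt.1 hik), ov_ge (not_lt.1 hik), ov_lt (by omega), hs i hi,
            ov_ge (not_lt.1 hik)]
      · by_cases hik : i < k
        · rw [ov_lt hik, hs i (by omega), ov_lt hik]
        · rw [ov_ge (not_lt.1 hik), ov_lt hi]
      · rw [ov_ge (by omega), ov_ge le_rfl]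
    obtain ⟨a1, a2, a3⟩ := gen s p₀ false hs
    obtain ⟨b1, b2, b3⟩ := gen t p₁ true ht
    refine ⟨m + 1, fun b => if b then ov t m (fun _ => true) else ov s m (fun _ => false),
      by omega, ?_, ?_⟩
    · intro a b x y hx hy
      refine hp (q a) (q b) ⟨⟨a, rfl⟩, ⟨b, rfl⟩⟩ x y (fun i hi => ?_) (fun i hi => ?_)
      · rw [hx i (by omega)]
        exact a1 _ i hi
      · rw [hy i (by omega)]
        exact b1 _ i hi
    · intro x y hx hy hxy
      refine hst x y (fun i hi => ?_) ?_ (fun i hi => ?_) ?_ hxy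
      · rw [hx i (by omega)]
        exact a2 i hi
      · rw [hx m (by omega)]
        exact a3
      · rw [hy i (by omega)]
        exact b2 i hi
      · rw [hy m (by omega)]
        exact b3
  choose! nk np h1 h2 h3 using hstep
  let st : ℕ → ℕ × ((ℕ → Bool) → (ℕ → Bool)) := fun n => Nat.rec (0, fun _ _ => false)
    (fun n c => (nk n c.1 c.2, fun a => ov (c.2 a) c.1 (np n c.1 c.2 (a n)))) n
  let K : ℕ → ℕ := fun n => (st n).1
  let q : ℕ → (ℕ → Bool) → (ℕ → Bool) := fun n => (st n).2
  let p : ℕ → Bool → ℕ → Bool := fun n => np n (K n) (q n)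
  have hq : ∀ n a, q (n + 1) a = ov (q n a) (K n) (p n (a n)) := fun n a => rfl
  have hfin : ∀ n, (range (q n)).Finite := by
    intro n
    induction n with
    | zero => exact (Set.finite_singleton (fun _ => false)).subset (by rintro _ ⟨a, rfl⟩; rfl)
    | succ n ih =>
      refine (Set.Finite.image2 (fun u b => ov u (K n) (p n b)) ih (Set.finite_univ)).subset ?_
      rintro _ ⟨a, rfl⟩
      exact ⟨q n a, ⟨a, rfl⟩, a n, mem_univ _, rfl⟩
  have hK : ∀ n, K n < K (n + 1) := fun n => h1 n _ _ (hfin n)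
  have hD : ∀ n a b x y, (∀ i < K (n + 1), x i = ov (q n a) (K n) (p n false) i) →
        (∀ i < K (n + 1), y i = ov (q n b) (K n) (p n true) i) → (x, y) ∈ D n :=
    fun n => h2 n _ _ (hfin n)
  have hE : ∀ n x y, (∀ i < K (n + 1), x i = ov (q n fun _ => false) (K n) (p n false) i) →
        (∀ i < K (n + 1), y i = ov (q n fun _ => false) (K n) (p n true) i) →
        (∀ i ≥ K (n + 1), x i = y i) → R x y :=
    fun n => h3 n _ _ (hfin n)
  have hK0 : K 0 = 0 := rfl
  clear_value p q K
  have hKn : ∀ n, n ≤ K n := by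
    intro n
    induction n with
    | zero => omega
    | succ n ih => have := hK n; omega
  have hKm : Monotone K := monotone_nat_of_le_succ fun n => (hK n).le
  have stab : ∀ a n m, n ≤ m → ∀ j < K n, q m a j = q n a j := by
    intro a n m hnm
    induction m, hnm using Nat.le_induction with
    | base => intro j _; rfl
    | succ m hnm ih =>
      intro j hj
      rw [hq, ov_lt (hj.trans_le (hKm hnm)), ih j hj]
  let ψ : (ℕ → Bool) → (ℕ → Bool) := fun a j => q (j + 1) a j
  have hψ : ∀ a n j, j < K n → ψ a j = q n a j := by
    intro a n j hj
    have hj' : j < K (j + 1) := hKn (j + 1)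
    rcases le_total n (j + 1) with h | h
    · exact stab a n (j + 1) h j hj
    · exact (stab a (j + 1) n h j hj').symm
  have hψ' : ∀ a n, ∀ i < K (n + 1), ψ a i = ov (q n a) (K n) (p n (a n)) i := by
    intro a n i hi
    rw [hψ a (n + 1) i hi, hq]
  have hloc : ∀ n a b, (∀ i < n, a i = b i) → (∀ i < K n, q n a i = q n b i) := by
    intro n
    induction n with
    | zero =>
      intro a b _ i hi
      omega
    | succ n ih =>
      intro a b hab i hi
      rw [hq, hq, hab n (by omega)]
      by_cases hin : i < K n
      · rw [ov_lt hin, ov_lt hin]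
        exact ih a b (fun j hj => hab j (by omega)) i hin
      · rw [ov_ge (not_lt.1 hin), ov_ge (not_lt.1 hin)]
  have htail : ∀ n a b, (∀ i ≥ n, a i = b i) → ∀ j ≥ K n, ψ a j = ψ b j := by
    intro n a b hab
    have : ∀ m, n ≤ m → ∀ j, K n ≤ j → j < K m → q m a j = q m b j := by
      intro m hm
      induction m, hm using Nat.le_induction with
      | base => intro j h1 h2; omega
      | succ m hm ih =>
        intro j h1 h2
        rw [hq, hq, hab m hm]
        by_cases hj : j < K m
        · rw [ov_lt hj, ov_lt hj]
          exact ih j h1 hj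
        · rw [ov_ge (not_lt.1 hj), ov_ge (not_lt.1 hj)]
    intro j hj
    have hjm : j < K (max n (j + 1)) := lt_of_lt_of_le (hKn (j + 1)) (hKm (le_max_right _ _))
    rw [hψ a _ j hjm, hψ b _ j hjm]
    exact this _ (le_max_left _ _) j hj hjm
  refine ⟨ψ, ?_, ?_⟩
  · refine continuous_pi fun j => ?_
    rw [continuous_iff_continuousAt]
    intro x
    refine tendsto_const_nhds.congr' (f₁ := fun _ => ψ x j) ?_
    filter_upwards [(PiNat.isOpen_cylinder (fun _ => Bool) x (j + 1)).mem_nhds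
      (PiNat.self_mem_cylinder x (j + 1))] with y hy
    exact (hloc (j + 1) y x hy j (hKn (j + 1))).symm
  intro a b
  constructor
  · intro hab
    have main : ∀ n a b, (∀ i ≥ n, a i = b i) → R (ψ a) (ψ b) := by
      intro n
      induction n with
      | zero =>
        intro a b hab
        obtain rfl : a = b := funext fun i => hab i (by omega)
        exact hR.refl _
      | succ n ih =>
        intro a b hab
        let a' := ov (fun _ => false) n a
        let b' := ov (fun _ => false) n b
        have ha : R (ψ a) (ψ a') := ih a a' fun i hi => (ov_ge hi).symm
        have hb : R (ψ b) (ψ b') := ih b b' fun i hi => (ov_ge hi).symm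
        refine hR.trans ha (hR.trans ?_ (hR.symm hb))
        have hab' : ∀ i ≥ n + 1, a' i = b' i := by
          intro i hi
          simp only [a', b']
          rw [ov_ge (by omega), ov_ge (by omega), hab i hi]
        have key : ∀ c d : ℕ → Bool, (∀ i < n, c i = false) → (∀ i < n, d i = false) →
            c n = false → d n = true → (∀ i ≥ n + 1, c i = d i) → R (ψ c) (ψ d) := by
          intro c d hc hd hcn hdn hcd
          have aux : ∀ (c : ℕ → Bool), (∀ i < n, c i = false) → ∀ i < K (n + 1),
              ψ c i = ov (q n fun _ => false) (K n) (p n (c n)) i := by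
            intro c hc i hi
            rw [hψ' c n i hi]
            by_cases hin : i < K n
            · rw [ov_lt hin, ov_lt hin]
              exact hloc n c _ hc i hin
            · rw [ov_ge (not_lt.1 hin), ov_ge (not_lt.1 hin)]
          refine hE n _ _ ?_ ?_ (htail (n + 1) c d hcd)
          · have h := aux c hc; rwa [hcn] at h
          · have h := aux d hd; rwa [hdn] at h
        have ha0 : ∀ i < n, a' i = false := fun i hi => ov_lt hi
        have hb0 : ∀ i < n, b' i = false := fun i hi => ov_lt hi
        cases han : a' n <;> cases hbn : b' n
        · refine ih _ _ fun i hi => ?_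
          rcases eq_or_lt_of_le hi with rfl | hi
          · rw [han, hbn]
          · exact hab' i hi
        · exact key _ _ ha0 hb0 han hbn hab'
        · exact hR.symm (key _ _ hb0 ha0 hbn han fun i hi => (hab' i hi).symm)
        · refine ih _ _ fun i hi => ?_
          rcases eq_or_lt_of_le hi with rfl | hi
          · rw [han, hbn]
          · exact hab' i hi
    obtain ⟨N, hN⟩ := hab.bddAbove
    refine main (N + 1) a b fun i hi => ?_
    by_contra hne
    have := hN (show i ∈ {n : ℕ | a n ≠ b n} from hne)
    omega
  · intro hab
    by_contra hinf
    have key : ∀ c d : ℕ → Bool, {n | c n = false ∧ d n = true}.Infinite → ¬ R (ψ c) (ψ d) := by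
      intro c d hcd
      refine hDR _ _ fun n => ?_
      obtain ⟨m, ⟨hc, hd⟩, hm⟩ := hcd.exists_gt n
      refine hDa hm.le (hD m c d _ _ ?_ ?_)
      · rw [← hc]; exact hψ' c m
      · rw [← hd]; exact hψ' d m
    have hu : {n : ℕ | a n ≠ b n} ⊆
        {n | a n = false ∧ b n = true} ∪ {n | b n = false ∧ a n = true} := by
      intro n hn
      have hb : ∀ u v : Bool, u ≠ v → (u = false ∧ v = true) ∨ (v = false ∧ u = true) := by decide
      exact hb _ _ hn
    have hinf' : ({n | a n = false ∧ b n = true} ∪ {n | b n = false ∧ a n = true}).Infinite :=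
      Set.Infinite.mono hu hinf
    rcases Set.infinite_union.1 hinf' with h | h
    · exact key a b h hab
    · exact key b a h (hR.symm hab)

end Embedding

lemma exists_schedule : ∃ (ty : ℕ → Bool) (S T : ℕ → ℕ → Bool),
    (∀ n, ty n = false → S n = T n) ∧
    (∀ (α : ℕ → Bool) (k : ℕ), ∃ n ≥ k, ty n = false ∧ ∀ i < k, S n i = α i) ∧
    (∀ (α β : ℕ → Bool) (k : ℕ), ∃ n ≥ k, ty n = true ∧ (∀ i < k, S n i = α i) ∧
      ∀ i < k, T n i = β i) := by
  obtain ⟨e, he⟩ := exists_surjective_nat (Bool × List Bool × List Bool)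
  have hlist : ∀ (α : ℕ → Bool) (k : ℕ), ∀ i < k, ((List.range k).map α).getD i false = α i := by
    intro α k i hi
    simp [List.getD, hi]
  refine ⟨fun n => (e n.unpair.1).1, fun n i => (e n.unpair.1).2.1.getD i false,
    fun n i => if (e n.unpair.1).1 then (e n.unpair.1).2.2.getD i false
      else (e n.unpair.1).2.1.getD i false, ?_, ?_, ?_⟩
  · intro n hn
    funext i
    simp only [hn]
    rfl
  · intro α k
    obtain ⟨m, hm⟩ := he (false, (List.range k).map α, [])
    refine ⟨Nat.pair m k, Nat.right_le_pair m k, ?_, ?_⟩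
    · simp only [Nat.unpair_pair, hm]
    · simp only [Nat.unpair_pair, hm]
      exact hlist α k
  · intro α β k
    obtain ⟨m, hm⟩ := he (true, (List.range k).map α, (List.range k).map β)
    refine ⟨Nat.pair m k, Nat.right_le_pair m k, ?_, ?_, ?_⟩
    · simp only [Nat.unpair_pair, hm]
    · simp only [Nat.unpair_pair, hm]
      exact hlist α k
    · simp only [Nat.unpair_pair, hm, if_true]
      exact hlist β k

theorem main_metric {X : Type*} [MetricSpace X] [CompleteSpace X] [SecondCountableTopology X]
    [MeasurableSpace X] [BorelSpace X]
    {W : Type*} [MetricSpace W] [CompleteSpace W] [SecondCountableTopology W]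
    [MeasurableSpace W] [BorelSpace W] {E : X → X → Prop} (hE : Equivalence E)
    (hEB : MeasurableSet {p : X × X | E p.1 p.2})
    {fE fG : W → X × X} (hfE : Continuous fE) (hfG : Continuous fG)
    (hrE : range fE = {p : X × X | E p.1 p.2}) (hrG : range fG = {p : X × X | E p.1 p.2}ᶜ)
    (w₀ : W) :
    (∃ f : X → ℝ, Measurable f ∧ ∀ x y : X, E x y ↔ f x = f y) ∨
    (∃ g : (ℕ → Bool) → X, Measurable g ∧
      ∀ a b : ℕ → Bool, {n : ℕ | a n ≠ b n}.Finite ↔ E (g a) (g b)) := by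
  by_cases hs : Small E 0 (univ : Set (List Bool → X × W))
  · left
    obtain ⟨A, B, hd, hb⟩ := hs
    refine smooth_of_cover hE hEB hd fun x => ?_
    rcases hb (fun _ => (x, w₀)) (mem_univ _) with ⟨s, t, _, _, i, hi⟩ | ⟨s, _, k, hk⟩
    · exact absurd Iff.rfl hi
    · exact ⟨k, hk⟩
  · right
    obtain ⟨ty, S, T, hST, hden0, hden1⟩ := exists_schedule
    obtain ⟨Φ, hΦ, hedge⟩ := exists_hom hE hEB hs hfE hfG hrE hrG ty S T hST
    let R : (ℕ → Bool) → (ℕ → Bool) → Prop := fun x y => E (Φ x) (Φ y)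
    have hR : Equivalence R := ⟨fun x => hE.refl _, fun h => hE.symm h, fun h h' => hE.trans h h'⟩
    have hRm : MeasurableSet {p : (ℕ → Bool) × (ℕ → Bool) | R p.1 p.2} :=
      ((hΦ.measurable.comp measurable_fst).prodMk (hΦ.measurable.comp measurable_snd)) hEB
    obtain ⟨D, hDo, hDd, hDa, hDR⟩ := exists_dense_open hR hRm (by
      intro α k
      obtain ⟨n, hn, hty, hS⟩ := hden0 α k
      refine ⟨n, hn, S n, hS, fun x y hx hxn hy hyn hxy => ?_⟩
      exact (hedge n x y hx hxn (by rwa [← hST n hty]) hyn hxy).2 hty)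
    obtain ⟨ψ, hψ, hred⟩ := exists_embedding hR hDo hDd hDa hDR (by
      intro α β k
      obtain ⟨n, hn, hty, hS, hT⟩ := hden1 α β k
      refine ⟨n, hn, S n, T n, hS, hT, fun x y hx hxn hy hyn hxy => ?_⟩
      exact (hedge n x y hx hxn hy hyn hxy).1 hty)
    exact ⟨Φ ∘ ψ, (hΦ.comp hψ).measurable, hred⟩

theorem main_polish {X : Type*} [TopologicalSpace X] [PolishSpace X]
    [MeasurableSpace X] [BorelSpace X] {E : X → X → Prop} (hE : Equivalence E)
    (hEB : MeasurableSet {p : X × X | E p.1 p.2}) :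
    (∃ f : X → ℝ, Measurable f ∧ ∀ x y : X, E x y ↔ f x = f y) ∨
    (∃ g : (ℕ → Bool) → X, Measurable g ∧
      ∀ a b : ℕ → Bool, {n : ℕ | a n ≠ b n}.Finite ↔ E (g a) (g b)) := by
  by_cases htriv : ∀ x y, E x y
  · exact Or.inl ⟨fun _ => 0, measurable_const, fun x y => by simp [htriv]⟩
  push Not at htriv
  obtain ⟨x₀, y₀, hxy⟩ := htriv
  have h1 := hEB.analyticSet
  have h2 := hEB.compl.analyticSet
  rw [AnalyticSet] at h1 h2
  rcases h1 with h1 | ⟨fE, hfE, hrE⟩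
  · have : (x₀, x₀) ∈ {p : X × X | E p.1 p.2} := hE.refl x₀
    rw [h1] at this
    exact this.elim
  rcases h2 with h2 | ⟨fG, hfG, hrG⟩
  · have : (x₀, y₀) ∈ {p : X × X | E p.1 p.2}ᶜ := hxy
    rw [h2] at this
    exact this.elim
  letI := TopologicalSpace.upgradeIsCompletelyMetrizable X
  letI := TopologicalSpace.upgradeIsCompletelyMetrizable (ℕ → ℕ)
  exact main_metric hE hEB hfE hfG hrE hrG (fun _ => 0)

end HKL

/-- The Harrington–Kechris–Louveau dichotomy: a Borel equivalence relation on a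
standard Borel space is either Borel reducible to equality on `ℝ`, or `E₀` is
Borel reducible to it. -/
theorem harrington_kechris_louveau {X : Type*} [MeasurableSpace X] [StandardBorelSpace X]
    (E : X → X → Prop) (hEquiv : Equivalence E)
    (hBorel : MeasurableSet {p : X × X | E p.1 p.2}) :
    (∃ f : X → ℝ, Measurable f ∧ ∀ x y : X, E x y ↔ f x = f y) ∨
    (∃ g : (ℕ → Bool) → X, Measurable g ∧ ∀ a b : ℕ → Bool, E0 a b ↔ E (g a) (g b)) := by
  letI := upgradeStandardBorel X
  exact HKL.main_polish hEquiv hBorel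
end

section
/- The relation E₀ is not smooth: there is no Borel (measurable) map f : 2^ℕ → ℝ such that for all a, b ∈ 2^ℕ, a E₀ b if and only if f(a) = f(b). -/
/-- Translation by `d` in Cantor space. -/
def flipH (d : ℕ → Bool) : (ℕ → Bool) ≃ₜ (ℕ → Bool) where
  toFun x := fun n => xor (d n) (x n)
  invFun x := fun n => xor (d n) (x n)
  left_inv x := by funext n; simp
  right_inv x := by funext n; simp
  continuous_toFun := by
    refine continuous_pi fun n => ?_
    exact (continuous_of_discreteTopology (f := fun b : Bool => xor (d n) b)).comp
      (continuous_apply n)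
  continuous_invFun := by
    refine continuous_pi fun n => ?_
    exact (continuous_of_discreteTopology (f := fun b : Bool => xor (d n) b)).comp
      (continuous_apply n)

theorem flipH_ev (d : ℕ → Bool) {p : (ℕ → Bool) → Prop} (h : ∀ᶠ x in residual (ℕ → Bool), p x) :
    ∀ᶠ x in residual (ℕ → Bool), p (flipH d x) := by
  rw [← (flipH d).residual_map_eq] at h
  exact h

theorem flipH_dense {V : Set (ℕ → Bool)} (hV : IsOpen V)
    {u v : ℕ → Bool} (hv : v ∈ V) :
    ∃ d : ℕ → Bool, {n | d n ≠ false}.Finite ∧ flipH d u ∈ V := by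
  obtain ⟨I, w, hw, hI⟩ := isOpen_pi_iff.1 hV v hv
  refine ⟨fun n => if n ∈ I then xor (u n) (v n) else false, ?_, ?_⟩
  · refine I.finite_toSet.subset fun n hn => ?_
    by_contra h
    have h' : n ∉ I := h
    simp [h'] at hn
  · apply hI
    intro n hn
    have hn' : n ∈ I := hn
    have : flipH (fun n => if n ∈ I then xor (u n) (v n) else false) u n = v n := by
      simp only [flipH, Homeomorph.homeomorph_mk_coe, Equiv.coe_fn_mk, hn', if_true]
      cases u n <;> cases v n <;> rfl
    rw [this]
    exact (hw n hn').2

theorem zero_one (A : Set (ℕ → Bool)) (hA : MeasurableSet A)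
    (inv : ∀ a b, E0 a b → a ∈ A → b ∈ A) :
    (∀ᶠ x in residual (ℕ → Bool), x ∈ A) ∨ (∀ᶠ x in residual (ℕ → Bool), x ∉ A) := by
  obtain ⟨U, hU, hAU⟩ := hA.residualEq_isOpen
  obtain ⟨V, hV, hAV⟩ := hA.compl.residualEq_isOpen
  have hAU' := Filter.eventuallyEq_set.1 hAU
  have hAV' := Filter.eventuallyEq_set.1 hAV
  rcases U.eq_empty_or_nonempty with rfl | ⟨u, hu⟩
  · right
    filter_upwards [hAU'] with x hx h
    exact hx.1 h
  rcases V.eq_empty_or_nonempty with rfl | ⟨v, hv⟩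
  · left
    filter_upwards [hAV'] with x hx
    by_contra h
    exact hx.1 h
  exfalso
  obtain ⟨d, hd, hdV⟩ := flipH_dense hV (u := u) hv
  have hres : ∀ᶠ x in residual (ℕ → Bool),
      (x ∈ A ↔ x ∈ U) ∧ (flipH d x ∈ Aᶜ ↔ flipH d x ∈ V) :=
    hAU'.and (flipH_ev d hAV')
  have hopen : IsOpen (U ∩ flipH d ⁻¹' V) := hU.inter (hV.preimage (flipH d).continuous)
  obtain ⟨x, ⟨hxU, hxV⟩, h1, h2⟩ :=
    (dense_of_mem_residual hres).inter_open_nonempty _ hopen ⟨u, hu, hdV⟩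
  refine h2.2 hxV (inv x _ ?_ (h1.2 hxU))
  refine hd.subset fun n hn h => hn ?_
  simp [flipH, h]

/-- `E₀` is not smooth: there is no Borel map `f : 2^ℕ → ℝ` such that
`a E₀ b ↔ f a = f b`. -/
theorem E0_not_smooth :
    ¬ ∃ f : (ℕ → Bool) → ℝ, Measurable f ∧ ∀ a b : ℕ → Bool, E0 a b ↔ f a = f b := by
  rintro ⟨f, hf, h⟩
  obtain ⟨c, hc⟩ := Filter.exists_eventuallyEq_const_of_forall_separating
    (l := residual (ℕ → Bool)) (f := f) MeasurableSet (fun U hU =>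
      zero_one (f ⁻¹' U) (hf hU) (fun a b hab ha => by
        rw [Set.mem_preimage, ← (h a b).1 hab]; exact ha))
  have h2 := hc.and (flipH_ev (fun _ => true) hc)
  obtain ⟨x, hx1, hx2⟩ := (dense_of_mem_residual h2).nonempty
  have h3 : E0 x (flipH (fun _ => true) x) := (h _ _).2 (hx1.trans hx2.symm)
  refine Set.infinite_univ (h3.subset fun n _ => ?_)
  simp [flipH]
end

section
/- E₀ and the Vitali equivalence relation E_V are Borel bireducible: there exists a Borel map f : 2^ℕ → ℝ such that a E₀ b if and only if f(a) − f(b) ∈ ℚ, and there exists a Borel map g : ℝ → 2^ℕ such that x − y ∈ ℚ if and only if g(x) E₀ g(y). -/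
/-- indicator of a Boolean as a real -/
noncomputable def bR (b : Bool) : ℝ := if b then 1 else 0

lemma bR_le (b c : Bool) : |bR b - bR c| ≤ 1 := by
  cases b <;> cases c <;> simp [bR]

lemma bR_eq (b c : Bool) (h : bR b - bR c = 0) : b = c := by
  cases b <;> cases c <;> simp_all [bR]

lemma bR_int (b c : Bool) : ∃ z : ℤ, bR b - bR c = z := by
  cases b <;> cases c
  · exact ⟨0, by simp [bR]⟩
  · exact ⟨-1, by simp [bR]⟩
  · exact ⟨1, by simp [bR]⟩
  · exact ⟨0, by simp [bR]⟩

lemma summable_inv_fact : Summable (fun n : ℕ => 1 / (n.factorial : ℝ)) := by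
  simpa using Real.summable_pow_div_factorial 1

/-- the first reduction -/
noncomputable def fR (a : ℕ → Bool) : ℝ := ∑' n, bR (a n) / (n.factorial : ℝ)

lemma bR_bound (b : Bool) (n : ℕ) : ‖bR b / (n.factorial : ℝ)‖ ≤ 1 / (n.factorial : ℝ) := by
  have := bR_le b false
  simp only [norm_div, Real.norm_eq_abs, Nat.abs_cast]
  gcongr
  simpa [bR] using this

lemma fR_meas : Measurable fR := by
  have : Continuous fR := by
    unfold fR
    refine continuous_tsum (fun n => ?_) summable_inv_fact (fun n a => bR_bound (a n) n)
    have h : Continuous bR := continuous_of_discreteTopology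
    exact (h.comp (continuous_apply n)).div_const _
  exact this.measurable

lemma fR_sub (a b : ℕ → Bool) :
    fR a - fR b = ∑' n, (bR (a n) - bR (b n)) / (n.factorial : ℝ) := by
  unfold fR
  rw [← Summable.tsum_sub]
  · simp only [sub_div]
  · exact Summable.of_norm_bounded summable_inv_fact (fun n => bR_bound (a n) n)
  · exact Summable.of_norm_bounded summable_inv_fact (fun n => bR_bound (b n) n)

lemma tail_lt (d : ℕ → ℝ) (hd : ∀ n, |d n| ≤ 1) (n : ℕ) (hn : 2 ≤ n) :
    |(n.factorial : ℝ) * ∑' k, d (k + (n + 1)) / ((k + (n + 1)).factorial : ℝ)| < 1 := by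
  have hn' : (2 : ℝ) ≤ n := by exact_mod_cast hn
  rw [← tsum_mul_left]
  have hg : HasSum (fun k : ℕ => (1 / ((n : ℝ) + 1)) * (1 / ((n : ℝ) + 1)) ^ k)
      ((1 / ((n : ℝ) + 1)) * (1 - 1 / ((n : ℝ) + 1))⁻¹) := by
    apply HasSum.mul_left
    apply hasSum_geometric_of_lt_one (by positivity)
    rw [div_lt_one (by positivity)]; linarith
  have := tsum_of_norm_bounded (f := fun k : ℕ => (n.factorial : ℝ) *
    (d (k + (n + 1)) / ((k + (n + 1)).factorial : ℝ))) hg ?_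
  · rw [Real.norm_eq_abs] at this
    refine this.trans_lt ?_
    have h1 : 1 - 1 / ((n : ℝ) + 1) = n / (n + 1) := by field_simp; ring
    rw [h1, inv_div, ← mul_div_assoc, one_div_mul_cancel (by positivity), div_lt_one (by positivity)]
    linarith
  · intro k
    have h2 : (n.factorial : ℝ) * ((n : ℝ) + 1) ^ (k + 1) ≤ ((k + (n + 1)).factorial : ℝ) := by
      have := Nat.factorial_mul_pow_le_factorial (m := n) (n := k + 1)
      rw [show k + (n + 1) = n + (k + 1) by ring]
      exact_mod_cast this
    have hp : (0 : ℝ) < n.factorial := by positivity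
    rw [norm_mul, norm_div, Real.norm_eq_abs, Real.norm_eq_abs, Real.norm_eq_abs,
      Nat.abs_cast, Nat.abs_cast, ← pow_succ', one_div, inv_pow, ← mul_div_assoc,
      div_le_iff₀ (by positivity), ← div_eq_inv_mul, le_div_iff₀ (by positivity)]
    calc _ ≤ (n.factorial : ℝ) * 1 * ((n : ℝ) + 1) ^ (k + 1) := by
            gcongr; exact hd _
      _ ≤ _ := by simpa using h2

lemma fR_red (a b : ℕ → Bool) : E0 a b ↔ ∃ q : ℚ, fR a - fR b = (q : ℝ) := by
  choose z hz using fun n => bR_int (a n) (b n)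
  rw [fR_sub]
  constructor
  · intro h
    rw [tsum_eq_sum (s := h.toFinset)]
    · refine ⟨∑ n ∈ h.toFinset, (z n : ℚ) / (n.factorial : ℚ), ?_⟩
      push_cast
      exact Finset.sum_congr rfl fun n _ => by rw [hz]
    · intro n hn
      have : a n = b n := by
        by_contra hne
        exact hn ((Set.Finite.mem_toFinset h).mpr hne)
      simp [this]
  · rintro ⟨q, hq⟩
    set d : ℕ → ℝ := fun n => bR (a n) - bR (b n) with hd
    have hdb : ∀ n, |d n| ≤ 1 := fun n => bR_le _ _
    have hs : Summable (fun n => d n / (n.factorial : ℝ)) := by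
      refine Summable.of_norm_bounded summable_inv_fact (fun n => ?_)
      rw [norm_div, Real.norm_eq_abs, Real.norm_eq_abs, Nat.abs_cast]
      gcongr
      exact hdb n
    have key : ∀ n, 2 ≤ n → q.den ≤ n →
        ∑' k, d (k + (n + 1)) / ((k + (n + 1)).factorial : ℝ) = 0 := by
      intro n h2 hqn
      have h1 := hs.sum_add_tsum_nat_add (n + 1)
      rw [hq] at h1
      have hint : ∃ w : ℤ, (n.factorial : ℝ) *
          ∑' k, d (k + (n + 1)) / ((k + (n + 1)).factorial : ℝ) = w := by
        obtain ⟨c, hc⟩ := Nat.dvd_factorial q.den_pos hqn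
        refine ⟨c * q.num - ∑ i ∈ Finset.range (n + 1),
          z i * ((n.factorial / i.factorial : ℕ) : ℤ), ?_⟩
        have e1 : (n.factorial : ℝ) * (q : ℝ) = c * q.num := by
          have h3 : (q : ℝ) * q.den = q.num := by exact_mod_cast Rat.mul_den_eq_num q
          rw [hc]; push_cast; rw [← h3]; ring
        have e2 : (n.factorial : ℝ) * ∑ i ∈ Finset.range (n + 1), d i / (i.factorial : ℝ)
            = ∑ i ∈ Finset.range (n + 1), (z i : ℝ) * ((n.factorial / i.factorial : ℕ) : ℝ) := by
          rw [Finset.mul_sum]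
          refine Finset.sum_congr rfl fun i hi => ?_
          rw [Nat.cast_div (Nat.factorial_dvd_factorial (by simp at hi; omega)) (by positivity),
            ← hz i]
          simp only [hd]; ring
        rw [Int.cast_sub, Int.cast_sum]
        simp only [Int.cast_mul, Int.cast_natCast]
        rw [← e2, ← e1, ← h1]; ring
      obtain ⟨w, hw⟩ := hint
      have hlt := tail_lt d hdb n h2
      rw [hw] at hlt
      have hw0 : w = 0 := by
        rw [← Int.abs_lt_one_iff]; exact_mod_cast hlt
      rw [hw0, Int.cast_zero] at hw
      exact (mul_eq_zero.mp hw).resolve_left (by positivity)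
    refine (Set.finite_lt_nat (q.den + 3)).subset ?_
    intro m hm
    by_contra hlt
    simp only [Set.mem_ofPred_eq, not_lt] at hlt
    obtain ⟨n, rfl⟩ : ∃ n, m = n + 1 := ⟨m - 1, by omega⟩
    have k1 := key n (by omega) (by omega)
    have k2 := key (n + 1) (by omega) (by omega)
    have s1 := hs.sum_add_tsum_nat_add (n + 1)
    have s2 := hs.sum_add_tsum_nat_add (n + 1 + 1)
    rw [k1] at s1
    rw [k2, Finset.sum_range_succ] at s2
    have h0 : d (n + 1) / ((n + 1).factorial : ℝ) = 0 := by linarith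
    have h00 : d (n + 1) = 0 := by
      rcases div_eq_zero_iff.mp h0 with h | h
      · exact h
      · exact absurd h (by positivity)
    exact hm (bR_eq _ _ h00)

/-- Cantor digits -/
noncomputable def cd (n : ℕ) (x : ℝ) : ℤ := ⌊((n : ℝ) + 1) * Int.fract ((n.factorial : ℝ) * x)⌋

lemma cd_meas (n : ℕ) : Measurable (cd n) := by
  unfold cd
  exact Int.measurable_floor.comp
    (measurable_const.mul (measurable_fract.comp (measurable_const.mul measurable_id)))

lemma cd_step (n : ℕ) (x : ℝ) : Int.fract (((n + 1).factorial : ℝ) * x) =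
    ((n : ℝ) + 1) * Int.fract ((n.factorial : ℝ) * x) - cd n x := by
  unfold cd
  rw [Int.self_sub_floor, Int.fract_eq_fract]
  refine ⟨(n + 1) * ⌊(n.factorial : ℝ) * x⌋, ?_⟩
  rw [Nat.factorial_succ, Int.fract]
  push_cast; ring

lemma cd_red (x y : ℝ) : (∃ q : ℚ, x - y = (q : ℝ)) ↔ {n | cd n x ≠ cd n y}.Finite := by
  constructor
  · rintro ⟨q, hq⟩
    refine (Set.finite_lt_nat q.den).subset ?_
    intro n hn
    by_contra hlt
    simp only [Set.mem_ofPred_eq, not_lt] at hlt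
    apply hn
    have : Int.fract ((n.factorial : ℝ) * x) = Int.fract ((n.factorial : ℝ) * y) := by
      rw [Int.fract_eq_fract]
      obtain ⟨c, hc⟩ := Nat.dvd_factorial q.den_pos hlt
      refine ⟨c * q.num, ?_⟩
      have h3 : (q : ℝ) * q.den = q.num := by exact_mod_cast Rat.mul_den_eq_num q
      rw [← mul_sub, hq, hc]; push_cast; rw [← h3]; ring
    simp only [cd, this]
  · intro h
    obtain ⟨N, hN⟩ := h.bddAbove
    obtain ⟨M, hMN⟩ : ∃ M, M = N + 1 := ⟨_, rfl⟩
    have hM : ∀ n, M ≤ n → cd n x = cd n y := by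
      intro n hn
      by_contra hne
      have : n ≤ N := hN hne
      omega
    set δ : ℕ → ℝ := fun n => |Int.fract ((n.factorial : ℝ) * x) - Int.fract ((n.factorial : ℝ) * y)|
      with hδ
    have hlt : ∀ n, δ n < 1 := by
      intro n
      have a1 := Int.fract_nonneg ((n.factorial : ℝ) * x)
      have a2 := Int.fract_nonneg ((n.factorial : ℝ) * y)
      have a3 := Int.fract_lt_one ((n.factorial : ℝ) * x)
      have a4 := Int.fract_lt_one ((n.factorial : ℝ) * y)
      simp only [hδ, abs_lt]
      constructor <;> linarith
    have hstep : ∀ n, M ≤ n → δ (n + 1) = ((n : ℝ) + 1) * δ n := by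
      intro n hn
      simp only [hδ]
      rw [cd_step, cd_step, hM n hn, sub_sub_sub_cancel_right, ← mul_sub, abs_mul,
        abs_of_nonneg (by positivity : (0 : ℝ) ≤ (n : ℝ) + 1)]
    have hgrow : ∀ k, 2 ^ k * δ M ≤ δ (M + k) := by
      intro k
      induction k with
      | zero => simp
      | succ k ih =>
        rw [← add_assoc, hstep (M + k) (by omega), pow_succ']
        have h1 : (2 : ℝ) ≤ ((M + k : ℕ) : ℝ) + 1 := by
          have : 2 ≤ M + k + 1 := by omega
          exact_mod_cast this
        have h0 : 0 ≤ δ M := abs_nonneg _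
        rw [mul_assoc]
        exact mul_le_mul h1 ih (by positivity) (by positivity)
    have hz : δ M = 0 := by
      by_contra hne
      have hpos : 0 < δ M := lt_of_le_of_ne (abs_nonneg _) (Ne.symm hne)
      obtain ⟨k, hk⟩ := pow_unbounded_of_one_lt (1 / δ M) (one_lt_two)
      rw [div_lt_iff₀ hpos] at hk
      linarith [hgrow k, hlt (M + k)]
    have := sub_eq_zero.mp (abs_eq_zero.mp hz)
    rw [Int.fract_eq_fract] at this
    obtain ⟨w, hw⟩ := this
    refine ⟨(w : ℚ) / (M.factorial : ℚ), ?_⟩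
    push_cast
    rw [← hw]
    have : (M.factorial : ℝ) ≠ 0 := by positivity
    field_simp

/-- the second reduction -/
noncomputable def gR (x : ℝ) (m : ℕ) : Bool :=
  decide (Encodable.encode (cd m.unpair.1 x) = m.unpair.2)

lemma gR_meas : Measurable gR := by
  refine measurable_pi_iff.mpr fun m => ?_
  exact (measurable_from_top (f := fun t : ℤ =>
    decide (Encodable.encode t = m.unpair.2))).comp (cd_meas m.unpair.1)

lemma gR_red (x y : ℝ) : {n | cd n x ≠ cd n y}.Finite ↔ E0 (gR x) (gR y) := by
  unfold E0
  constructor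
  · intro h
    refine ((h.image fun n => Nat.pair n (Encodable.encode (cd n x))).union
      (h.image fun n => Nat.pair n (Encodable.encode (cd n y)))).subset ?_
    intro m hm
    have hne : cd m.unpair.1 x ≠ cd m.unpair.1 y := by
      intro he
      apply hm
      simp only [gR, he]
    have aux : ∀ t, gR t m = true → Nat.pair m.unpair.1 (Encodable.encode (cd m.unpair.1 t)) = m := by
      intro t ht
      simp only [gR, decide_eq_true_eq] at ht
      rw [ht, Nat.pair_unpair]
    by_cases hx : gR x m = true
    · exact Or.inl ⟨_, hne, aux x hx⟩
    · by_cases hy : gR y m = true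
      · exact Or.inr ⟨_, hne, aux y hy⟩
      · simp_all
  · intro h
    refine (h.image fun m => m.unpair.1).subset ?_
    intro n hn
    refine ⟨Nat.pair n (Encodable.encode (cd n x)), ?_, by simp⟩
    have hn' : cd n y ≠ cd n x := fun e => hn e.symm
    simp [gR, hn']

/-- `E₀` and the Vitali equivalence relation are Borel bireducible. -/
theorem E0_bireducible_vitali :
    (∃ f : (ℕ → Bool) → ℝ, Measurable f ∧
      ∀ a b : ℕ → Bool, E0 a b ↔ ∃ q : ℚ, f a - f b = (q : ℝ)) ∧
    (∃ g : ℝ → (ℕ → Bool), Measurable g ∧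
      ∀ x y : ℝ, (∃ q : ℚ, x - y = (q : ℝ)) ↔ E0 (g x) (g y)) := by
  exact ⟨⟨fR, fR_meas, fR_red⟩, ⟨gR, gR_meas, fun x y => (cd_red x y).trans (gR_red x y)⟩⟩
end

section
/- The Vitali equivalence relation is not smooth: there is no Borel (measurable) map f : ℝ → ℝ such that for all x, y ∈ ℝ, x − y ∈ ℚ if and only if f(x) = f(y). -/
/-- The Vitali equivalence relation is not smooth: there is no Borel map
`f : ℝ → ℝ` with `x - y ∈ ℚ ↔ f x = f y`. -/
theorem vitali_not_smooth :
    ¬ ∃ f : ℝ → ℝ, Measurable f ∧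
      ∀ x y : ℝ, (∃ q : ℚ, x - y = (q : ℝ)) ↔ f x = f y := by
  rintro ⟨f, hf, h⟩
  have htr : ∀ a : ℝ, Filter.Tendsto (fun x : ℝ => x + a) (residual ℝ) (residual ℝ) :=
    fun a => tendsto_residual_of_isOpenMap (Homeomorph.addRight a).continuous
      (Homeomorph.addRight a).isOpenMap
  have hinv : ∀ (x : ℝ) (q : ℚ), f (x + q) = f x := fun x q =>
    (h _ _).1 ⟨q, by ring⟩
  have key : ∃ c, f =ᶠ[residual ℝ] Function.const ℝ c := by
    refine Filter.exists_eventuallyEq_const_of_forall_separating MeasurableSet fun U hU => ?_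
    obtain ⟨O, hO, hAO⟩ := (hf hU).residualEq_isOpen
    rw [Filter.eventuallyEq_set] at hAO
    rcases O.eq_empty_or_nonempty with rfl | ⟨y, hy⟩
    · right
      filter_upwards [hAO] with x hx
      simpa using hx
    · left
      have hD : (⋃ q : ℚ, (fun x : ℝ => x + q) ⁻¹' O) ∈ residual ℝ := by
        refine residual_of_dense_open
          (isOpen_iUnion fun q => hO.preimage (by fun_prop)) ?_
        refine dense_iff_inter_open.2 fun V hV ⟨v, hv⟩ => ?_
        have hW2 : IsOpen ((fun r : ℝ => v + r) ⁻¹' O) := hO.preimage (by fun_prop)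
        obtain ⟨q, hq⟩ := Rat.denseRange_cast.exists_mem_open hW2
          ⟨y - v, by simpa using hy⟩
        exact ⟨v, hv, Set.mem_iUnion.2 ⟨q, hq⟩⟩
      filter_upwards [hD, eventually_countable_forall.2
        (fun q : ℚ => (htr q).eventually hAO)] with x hx hx2
      obtain ⟨q, hq⟩ := Set.mem_iUnion.1 hx
      have := (hx2 q).2 hq
      rwa [Set.mem_preimage, hinv] at this
  obtain ⟨c, hc⟩ := key
  have h2 := hc.and ((htr √2).eventually hc)
  obtain ⟨x, hx1, hx2⟩ := (dense_of_mem_residual h2).nonempty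
  obtain ⟨q, hq⟩ := (h (x + √2) x).2 (hx2.trans hx1.symm)
  exact irrational_sqrt_two ⟨q, by rw [← hq]; ring⟩
end

section
/- The isomorphism equivalence relation on nonzero additive subgroups of ℚ is Borel bireducible with E₀: identifying subsets of ℚ with points of the Polish space 2^ℚ (= ℚ → Bool with the product topology), the set S of nonzero additive subgroups of ℚ is a Borel subset, and there exist Borel maps f : 2^ℕ → S and g : S → 2^ℕ such that a E₀ b if and only if f(a) and f(b) are isomorphic as additive groups, and subgroups A, B ∈ S are isomorphic as additive groups if and only if g(A) E₀ g(B). -/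
/-- The set of points of `2^ℚ` coding nonzero additive subgroups of `ℚ`. -/
def ratSubgroups : Set (ℚ → Bool) :=
  {A | ∃ H : AddSubgroup ℚ, H ≠ ⊥ ∧ ∀ q : ℚ, A q = true ↔ q ∈ H}

/-- Two codes are related if they code additive subgroups of `ℚ` that are
isomorphic as additive groups. -/
def ratIso (A B : ℚ → Bool) : Prop :=
  ∃ H K : AddSubgroup ℚ, (∀ q : ℚ, A q = true ↔ q ∈ H) ∧
    (∀ q : ℚ, B q = true ↔ q ∈ K) ∧ Nonempty (H ≃+ K)

namespace RatSG

def S (c : ℚ) (H : AddSubgroup ℚ) : AddSubgroup ℚ := H.comap (AddMonoidHom.mulLeft c)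

theorem mem_S {c x : ℚ} {H : AddSubgroup ℚ} : x ∈ S c H ↔ c * x ∈ H := Iff.rfl

theorem S_S (b c : ℚ) (H : AddSubgroup ℚ) : S b (S c H) = S (c * b) H := by
  ext x; simp only [mem_S, mul_assoc]

def D (H : AddSubgroup ℚ) : Set ℕ := {n | IsPrimePow n ∧ ((n : ℚ))⁻¹ ∈ H}

theorem zmul_mem {H : AddSubgroup ℚ} {x : ℚ} (n : ℤ) (hx : x ∈ H) : (n : ℚ) * x ∈ H := by
  simpa using H.zsmul_mem hx n

theorem nmul_mem {H : AddSubgroup ℚ} {x : ℚ} (n : ℕ) (hx : x ∈ H) : (n : ℚ) * x ∈ H := by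
  simpa using H.nsmul_mem hx n

/-- Bezout -/
theorem coprime_mem {H : AddSubgroup ℚ} {x : ℚ} {a b : ℤ} (hab : IsCoprime a b)
    (ha : (a : ℚ) * x ∈ H) (hb : (b : ℚ) * x ∈ H) : x ∈ H := by
  obtain ⟨u, v, huv⟩ := hab
  have h := H.add_mem (zmul_mem u ha) (zmul_mem v hb)
  have e : (u : ℚ) * (a * x) + v * (b * x) = x := by
    have : (u : ℚ) * a + v * b = 1 := by exact_mod_cast huv
    linear_combination x * this
  rwa [e] at h

theorem coprime_mem_nat {H : AddSubgroup ℚ} {x : ℚ} {a b : ℕ} (hab : Nat.Coprime a b)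
    (ha : (a : ℚ) * x ∈ H) (hb : (b : ℚ) * x ∈ H) : x ∈ H :=
  coprime_mem (a := a) (b := b) (Nat.isCoprime_iff_coprime.2 hab)
    (by simpa using ha) (by simpa using hb)

theorem inv_dvd_mem {H : AddSubgroup ℚ} {a b : ℕ} (hab : a ∣ b) (hb0 : b ≠ 0)
    (hb : (b : ℚ)⁻¹ ∈ H) : (a : ℚ)⁻¹ ∈ H := by
  obtain ⟨c, rfl⟩ := hab
  have := nmul_mem c hb
  have hc : (c : ℚ) ≠ 0 := by rintro h; apply hb0; simp_all
  rw [Nat.cast_mul, mul_inv, mul_comm, mul_assoc, inv_mul_cancel₀ hc, mul_one] at this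
  exact this

theorem le_of_D {L H : AddSubgroup ℚ} (hL : (1 : ℚ) ∈ L) (hH : (1 : ℚ) ∈ H)
    (h : D L ⊆ D H) : L ≤ H := by
  have key : ∀ n : ℕ, (n : ℚ)⁻¹ ∈ L → (n : ℚ)⁻¹ ∈ H := by
    intro n
    induction n using Nat.recOnPosPrimePosCoprime with
    | zero => intro _; simp
    | one => intro _; simpa using hH
    | prime_pow p n hp hn =>
      intro hx
      exact (h ⟨hp.isPrimePow.pow hn.ne', hx⟩).2
    | coprime a b ha hb hab iha ihb =>
      intro hx
      have h0 : a * b ≠ 0 := by positivity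
      have h1 := iha (inv_dvd_mem (Dvd.intro _ rfl) h0 hx)
      have h2 := ihb (inv_dvd_mem (Dvd.intro_left _ rfl) h0 hx)
      have ha0 : (a : ℚ) ≠ 0 := by positivity
      have hb0 : (b : ℚ) ≠ 0 := by positivity
      refine coprime_mem_nat hab ?_ ?_
      · convert h2 using 1; push_cast; field_simp
      · convert h1 using 1; push_cast; field_simp
  intro x hx
  have hd : (x.den : ℚ) ≠ 0 := by exact_mod_cast x.den_ne_zero
  have h1 : (x.den : ℚ)⁻¹ ∈ L := by
    refine coprime_mem (a := x.num) (b := x.den) ?_ ?_ ?_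
    · rw [Int.isCoprime_iff_gcd_eq_one]; exact x.reduced
    · rw [← div_eq_mul_inv, Rat.num_div_den]; exact hx
    · rw [Int.cast_natCast, mul_inv_cancel₀ hd]; exact hL
  have := zmul_mem x.num (key _ h1)
  rwa [← div_eq_mul_inv, Rat.num_div_den] at this

def Ap (s t : Set ℕ) : Prop := {n | ¬ (n ∈ s ↔ n ∈ t)}.Finite

theorem Ap.refl (s : Set ℕ) : Ap s s := by simp [Ap]

theorem Ap.symm {s t : Set ℕ} (h : Ap s t) : Ap t s :=
  h.subset fun n hn => by simp only [Set.mem_ofPred_eq] at *; tauto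

theorem Ap.trans {s t u : Set ℕ} (h : Ap s t) (h' : Ap t u) : Ap s u :=
  (h.union h').subset fun n hn => by
    simp only [Set.mem_ofPred_eq, Set.mem_union] at *; tauto

theorem one_mem_S {H : AddSubgroup ℚ} (h : (1 : ℚ) ∈ H) (n : ℕ) : (1 : ℚ) ∈ S n H := nmul_mem n h

theorem le_S {H : AddSubgroup ℚ} (n : ℕ) : H ≤ S n H := fun _ h => nmul_mem n h

theorem prime_mem {H : AddSubgroup ℚ} (h : (1 : ℚ) ∈ H) {p q k : ℕ} (hp : p.Prime) (hq : q.Prime)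
    (hpq : p ≠ q) (hk : (q : ℚ) * ((p ^ k : ℕ) : ℚ)⁻¹ ∈ H) : ((p ^ k : ℕ) : ℚ)⁻¹ ∈ H := by
  refine coprime_mem_nat (a := q) (b := p ^ k) ?_ hk ?_
  · exact Nat.Coprime.pow_right _ ((Nat.coprime_primes hq hp).2 hpq.symm)
  · rw [mul_inv_cancel₀ (by have := hp.pos; positivity)]; exact h

theorem prime_mem' {H : AddSubgroup ℚ} {q k : ℕ} (hq : q.Prime)
    (hk : (q : ℚ) * ((q ^ (k+1) : ℕ) : ℚ)⁻¹ ∈ H) : ((q ^ k : ℕ) : ℚ)⁻¹ ∈ H := by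
  have : (q : ℚ) ≠ 0 := by exact_mod_cast hq.ne_zero
  convert hk using 1
  push_cast; field_simp; ring

theorem Ap_prime {H : AddSubgroup ℚ} (h : (1 : ℚ) ∈ H) {q : ℕ} (hq : q.Prime) :
    Ap (D H) (D (S q H)) := by
  apply Set.Subsingleton.finite
  have key : ∀ n ∈ {n | ¬ (n ∈ D H ↔ n ∈ D (S q H))}, ∃ k, n = q ^ (k+1) ∧
      ((q ^ k : ℕ) : ℚ)⁻¹ ∈ H ∧ ((q ^ (k+1) : ℕ) : ℚ)⁻¹ ∉ H := by
    intro n hn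
    simp only [Set.mem_ofPred_eq, D, mem_S] at hn
    have hpp : IsPrimePow n := by tauto
    have h2 : (n : ℚ)⁻¹ ∉ H := fun hh => hn ⟨fun _ => ⟨hpp, nmul_mem q hh⟩, fun _ => ⟨hpp, hh⟩⟩
    have h3 : (q : ℚ) * (n : ℚ)⁻¹ ∈ H := by tauto
    obtain ⟨p, k, hp, hk, rfl⟩ := (isPrimePow_nat_iff n).1 hpp
    obtain rfl : p = q := by
      by_contra hne
      exact h2 (prime_mem h hp hq hne h3)
    obtain ⟨k, rfl⟩ := Nat.exists_eq_succ_of_ne_zero hk.ne'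
    exact ⟨k, rfl, prime_mem' hq h3, h2⟩
  intro n hn m hm
  obtain ⟨k, rfl, h1, h2⟩ := key n hn
  obtain ⟨l, rfl, h3, h4⟩ := key m hm
  have : ∀ k l : ℕ, ((q ^ k : ℕ) : ℚ)⁻¹ ∈ H → ((q ^ (l+1) : ℕ) : ℚ)⁻¹ ∉ H → k ≤ l := by
    intro k l h1 h2
    by_contra hlt
    exact h2 (inv_dvd_mem (pow_dvd_pow q (by omega)) (pow_ne_zero _ hq.ne_zero) h1)
  rw [le_antisymm (this k l h1 h4) (this l k h3 h2)]

theorem Ap_nat (n : ℕ) (hn : n ≠ 0) : ∀ {H : AddSubgroup ℚ}, (1 : ℚ) ∈ H →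
    Ap (D H) (D (S n H)) := by
  induction n using Nat.recOnMul with
  | zero => exact absurd rfl hn
  | one =>
    intro H _
    have : S ((1 : ℕ) : ℚ) H = H := by ext x; simp [mem_S]
    rw [this]; exact Ap.refl _
  | prime p hp => intro H h; exact Ap_prime h hp
  | mul a b iha ihb =>
    intro H h
    have := (iha (by rintro rfl; simp at hn) h).trans
      (ihb (by rintro rfl; simp at hn) (one_mem_S h a))
    rwa [S_S, ← Nat.cast_mul] at this

theorem S_neg (c : ℚ) (H : AddSubgroup ℚ) : S (-c) H = S c H := by
  ext x; simp [mem_S]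

theorem Ap_rat {c : ℚ} (hc : c ≠ 0) {H : AddSubgroup ℚ} (h : (1 : ℚ) ∈ H)
    (h' : (1 : ℚ) ∈ S c H) : Ap (D H) (D (S c H)) := by
  have h1 := Ap_nat c.num.natAbs (by simpa using hc) h
  have h2 := Ap_nat c.den c.den_ne_zero h'
  rw [S_S, Rat.mul_den_eq_num] at h2
  have : S (c.num.natAbs : ℚ) H = S (c.num : ℚ) H := by
    rcases Int.natAbs_eq c.num with e | e
    · conv_rhs => rw [e]
      simp
    · conv_rhs => rw [e]
      rw [Int.cast_neg, S_neg]; simp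
  rw [this] at h1
  exact h1.trans h2.symm

theorem exists_scale_le (N : ℕ) : ∀ {L H : AddSubgroup ℚ}, (1 : ℚ) ∈ L → L ≤ H →
    (D H \ D L).Finite → (D H \ D L).ncard = N → ∃ c : ℚ, c ≠ 0 ∧ H = S c L := by
  induction N using Nat.strong_induction_on with
  | _ N ih =>
  intro L H h1 hle hfin hN
  by_cases hsub : D H ⊆ D L
  · refine ⟨1, one_ne_zero, ?_⟩
    have : S 1 L = L := by ext x; simp [mem_S]
    rw [this]
    exact le_antisymm (le_of_D (hle h1) h1 hsub) hle
  · obtain ⟨n, hnH, hnL⟩ := Set.not_subset.1 hsub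
    have hex : ∃ p j : ℕ, p.Prime ∧ ((p ^ j : ℕ) : ℚ)⁻¹ ∈ L ∧ ((p ^ (j+1) : ℕ) : ℚ)⁻¹ ∉ L ∧
        ((p ^ (j+1) : ℕ) : ℚ)⁻¹ ∈ H := by
      obtain ⟨hpp, hnH⟩ := hnH
      have hnL : (n : ℚ)⁻¹ ∉ L := fun hh => hnL ⟨hpp, hh⟩
      obtain ⟨p, k, hp, hk, rfl⟩ := (isPrimePow_nat_iff n).1 hpp
      classical
      have hE : ∃ k, ((p ^ k : ℕ) : ℚ)⁻¹ ∉ L := ⟨k, hnL⟩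
      have hs := Nat.find_spec hE
      have hm : ∀ i < Nat.find hE, ((p ^ i : ℕ) : ℚ)⁻¹ ∈ L := fun i hi =>
        not_not.1 (Nat.find_min hE hi)
      have hlek : Nat.find hE ≤ k := Nat.find_min' hE hnL
      have h0 : Nat.find hE ≠ 0 := by
        intro h0; rw [h0] at hs; simp at hs; exact hs h1
      obtain ⟨j, hj⟩ := Nat.exists_eq_succ_of_ne_zero h0
      rw [hj] at hs hm hlek
      exact ⟨p, j, hp, hm j (Nat.lt_succ_self j), hs,
        inv_dvd_mem (pow_dvd_pow p hlek) (pow_ne_zero _ hp.ne_zero) hnH⟩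
    obtain ⟨p, j, hp, hj, hj1, hjH⟩ := hex
    have hp0 : (p : ℚ) ≠ 0 := by exact_mod_cast hp.ne_zero
    have hL'H : S p L ≤ H := by
      apply le_of_D (one_mem_S h1 p) (hle h1)
      rintro m ⟨hpp, hm⟩
      refine ⟨hpp, ?_⟩
      rw [mem_S] at hm
      obtain ⟨r, i, hr, hi, rfl⟩ := (isPrimePow_nat_iff m).1 hpp
      by_cases hrp : r = p
      · subst hrp
        obtain ⟨i, rfl⟩ := Nat.exists_eq_succ_of_ne_zero hi.ne'
        have hi := prime_mem' hp hm
        have : i ≤ j := by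
          by_contra hlt
          exact hj1 (inv_dvd_mem (pow_dvd_pow r (by omega)) (pow_ne_zero _ hp.ne_zero) hi)
        exact inv_dvd_mem (pow_dvd_pow r (by omega)) (pow_ne_zero _ hp.ne_zero) hjH
      · exact hle (prime_mem h1 hr hp hrp hm)
    have hDL : D L ⊆ D (S p L) := fun m hm => ⟨hm.1, le_S p hm.2⟩
    have hpp : IsPrimePow (p ^ (j+1)) := hp.isPrimePow.pow (Nat.succ_ne_zero j)
    have hss : D H \ D (S p L) ⊂ D H \ D L := by
      refine (Set.ssubset_iff_of_subset (Set.sdiff_subset_sdiff_right hDL)).2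
        ⟨p ^ (j+1), ⟨⟨hpp, hjH⟩, fun hh => hj1 hh.2⟩, fun hh => hh.2 ⟨hpp, ?_⟩⟩
      rw [mem_S]
      convert hj using 1
      push_cast; field_simp; ring
    obtain ⟨c, hc, e⟩ := ih _ (hN ▸ Set.ncard_lt_ncard hss hfin) (one_mem_S h1 p) hL'H
      (hfin.subset hss.subset) rfl
    exact ⟨p * c, mul_ne_zero hp0 hc, by rw [e, S_S]⟩

theorem scale_iff {H K : AddSubgroup ℚ} (hH : (1 : ℚ) ∈ H) (hK : (1 : ℚ) ∈ K) :
    (∃ c : ℚ, c ≠ 0 ∧ H = S c K) ↔ Ap (D H) (D K) := by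
  constructor
  · rintro ⟨c, hc, rfl⟩
    exact (Ap_rat hc hK hH).symm
  · intro h
    have hL : (1 : ℚ) ∈ H ⊓ K := ⟨hH, hK⟩
    obtain ⟨c, hc, e⟩ := exists_scale_le _ hL inf_le_left (h.subset (by
      rintro n ⟨h1, h2⟩ h3
      exact h2 ⟨h1.1, h1.2, (h3.1 h1).2⟩)) rfl
    obtain ⟨d, hd, e'⟩ := exists_scale_le _ hL inf_le_right (h.subset (by
      rintro n ⟨h1, h2⟩ h3
      exact h2 ⟨h1.1, (h3.2 h1).2, h1.2⟩)) rfl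
    refine ⟨d⁻¹ * c, mul_ne_zero (inv_ne_zero hd) hc, ?_⟩
    rw [e', S_S, mul_inv_cancel_left₀ hd]; exact e

theorem iso_iff {H K : AddSubgroup ℚ} (hH : H ≠ ⊥) :
    Nonempty (H ≃+ K) ↔ ∃ c : ℚ, c ≠ 0 ∧ H = S c K := by
  constructor
  · rintro ⟨φ⟩
    obtain ⟨h, hh, h0⟩ := H.bot_or_exists_ne_zero.resolve_left hH
    have key : ∀ x : H, (φ x : ℚ) = (φ ⟨h, hh⟩ : ℚ) / h * x := by
      intro x
      set r := (x : ℚ) / h with hr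
      have hd : (r.den : ℚ) ≠ 0 := by exact_mod_cast r.den_ne_zero
      have e : r.den • x = r.num • (⟨h, hh⟩ : H) := by
        apply Subtype.ext
        simp only [AddSubgroup.coe_nsmul, AddSubgroup.coe_zsmul, nsmul_eq_mul, zsmul_eq_mul]
        rw [← Rat.mul_den_eq_num, hr]; field_simp
      have e2 := congrArg (fun y => ((φ y : K) : ℚ)) e
      simp only [map_nsmul, map_zsmul, AddSubgroup.coe_nsmul, AddSubgroup.coe_zsmul,
        nsmul_eq_mul, zsmul_eq_mul] at e2
      rw [← Rat.mul_den_eq_num] at e2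
      have e3 : (φ x : ℚ) = r * φ ⟨h, hh⟩ := by
        apply mul_left_cancel₀ hd; rw [e2]; ring
      rw [e3, hr]; field_simp
    have hc : (φ ⟨h, hh⟩ : ℚ) / h ≠ 0 := by
      apply div_ne_zero _ h0
      intro hz
      have : φ ⟨h, hh⟩ = 0 := Subtype.ext hz
      rw [EmbeddingLike.map_eq_zero_iff] at this
      exact h0 (congrArg Subtype.val this)
    refine ⟨_, hc, ?_⟩
    ext x
    rw [mem_S]
    constructor
    · intro hx; rw [← key ⟨x, hx⟩]; exact (φ _).2
    · intro hx
      have h1 := key (φ.symm ⟨_, hx⟩)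
      rw [φ.apply_symm_apply] at h1
      have := mul_left_cancel₀ hc h1
      rw [this]; exact (φ.symm _).2
  · rintro ⟨c, hc, rfl⟩
    refine ⟨AddEquiv.mk' ⟨fun x => ⟨c * x, x.2⟩, fun y => ⟨c⁻¹ * y, ?_⟩, ?_, ?_⟩ ?_⟩
    · rw [mem_S, mul_inv_cancel_left₀ hc]; exact y.2
    · intro x; apply Subtype.ext; simp [hc]
    · intro x; apply Subtype.ext; simp [hc]
    · intro x y; apply Subtype.ext; simp [mul_add]

theorem ratIso_iff {A B : ℚ → Bool} {H K : AddSubgroup ℚ} (hA : ∀ q : ℚ, A q = true ↔ q ∈ H)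
    (hB : ∀ q : ℚ, B q = true ↔ q ∈ K) : ratIso A B ↔ Nonempty (H ≃+ K) := by
  constructor
  · rintro ⟨H', K', h1, h2, h⟩
    obtain rfl : H = H' := by ext x; rw [← hA, h1]
    obtain rfl : K = K' := by ext x; rw [← hB, h2]
    exact h
  · intro h; exact ⟨H, K, hA, hB, h⟩

theorem S_iff {H K : AddSubgroup ℚ} {h k : ℚ} (hh : h ≠ 0) (hk : k ≠ 0) :
    (∃ c : ℚ, c ≠ 0 ∧ H = S c K) ↔ (∃ c : ℚ, c ≠ 0 ∧ S h H = S c (S k K)) := by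
  constructor
  · rintro ⟨c, hc, rfl⟩
    refine ⟨k⁻¹ * (c * h), by positivity, ?_⟩
    rw [S_S, S_S, mul_inv_cancel_left₀ hk]
  · rintro ⟨c, hc, e⟩
    refine ⟨k * c * h⁻¹, by positivity, ?_⟩
    have := congrArg (S h⁻¹) e
    rw [S_S, S_S, S_S, mul_inv_cancel₀ hh] at this
    rw [mul_assoc, ← this]; ext x; simp [mem_S]

/-- the coding subgroup -/
def F (a : ℕ → Bool) : AddSubgroup ℚ where
  carrier := {q | ∀ n : ℕ, IsPrimePow n → n ∣ q.den → ∃ i, a i = true ∧ n = Nat.nth Nat.Prime i}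
  zero_mem' := by
    intro n hn hd
    simp at hd; subst hd; exact absurd hn not_isPrimePow_one
  add_mem' := by
    intro x y hx hy n hn hd
    have h := hd.trans (Rat.add_den_dvd_lcm x y)
    have : n ∣ x.den ∨ n ∣ y.den := by
      obtain ⟨p, k, hp, hk, rfl⟩ := (isPrimePow_nat_iff n).1 hn
      have hx0 := x.den_ne_zero
      have hy0 := y.den_ne_zero
      rw [hp.pow_dvd_iff_le_factorization (Nat.lcm_ne_zero hx0 hy0),
        Nat.factorization_lcm hx0 hy0] at h
      rw [hp.pow_dvd_iff_le_factorization hx0, hp.pow_dvd_iff_le_factorization hy0]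
      simpa using h
    exact this.elim (hx n hn) (hy n hn)
  neg_mem' := by
    intro x hx n hn hd
    exact hx n hn (by simpa using hd)

theorem one_mem_F (a : ℕ → Bool) : (1 : ℚ) ∈ F a := by
  intro n hn hd
  simp at hd; subst hd; exact absurd hn not_isPrimePow_one

theorem mem_D_F (a : ℕ → Bool) (n : ℕ) :
    n ∈ D (F a) ↔ ∃ i, a i = true ∧ n = Nat.nth Nat.Prime i := by
  have hden : ∀ n : ℕ, n ≠ 0 → ((n : ℚ)⁻¹).den = n := by
    intro n hn
    exact Rat.inv_natCast_den_of_pos (Nat.pos_of_ne_zero hn)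
  constructor
  · rintro ⟨hpp, h⟩
    exact h n hpp (by rw [hden n hpp.ne_zero])
  · rintro ⟨i, hi, rfl⟩
    have hp := Nat.prime_nth_prime i
    refine ⟨hp.isPrimePow, ?_⟩
    intro m hm hd
    rw [hden _ hp.ne_zero] at hd
    refine ⟨i, hi, ((Nat.dvd_prime hp).1 hd).resolve_left hm.ne_one⟩

theorem Ap_F (a b : ℕ → Bool) : E0 a b ↔ Ap (D (F a)) (D (F b)) := by
  have inj : Function.Injective (Nat.nth Nat.Prime) :=
    Nat.nth_injective Nat.infinite_setOfPred_prime
  have : {n | ¬ (n ∈ D (F a) ↔ n ∈ D (F b))} = Nat.nth Nat.Prime '' {n | a n ≠ b n} := by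
    ext n
    simp only [mem_D_F, Set.mem_ofPred_eq, Set.mem_image]
    constructor
    · intro h
      by_cases hex : ∃ i, n = Nat.nth Nat.Prime i
      · obtain ⟨i, rfl⟩ := hex
        refine ⟨i, fun hab => h ?_, rfl⟩
        constructor
        · rintro ⟨j, h1, h2⟩; obtain rfl := inj h2; exact ⟨i, hab ▸ h1, rfl⟩
        · rintro ⟨j, h1, h2⟩; obtain rfl := inj h2; exact ⟨i, hab ▸ h1, rfl⟩
      · exfalso; apply h
        constructor
        · rintro ⟨j, h1, h2⟩; exact absurd ⟨j, h2⟩ hex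
        · rintro ⟨j, h1, h2⟩; exact absurd ⟨j, h2⟩ hex
    · rintro ⟨i, hi, rfl⟩ h
      apply hi
      have e : ∀ c : ℕ → Bool, (∃ j, c j = true ∧ Nat.nth Nat.Prime i = Nat.nth Nat.Prime j) ↔
          c i = true := fun c =>
        ⟨fun ⟨j, h1, h2⟩ => by obtain rfl := inj h2; exact h1, fun h => ⟨i, h, rfl⟩⟩
      rw [e, e] at h
      exact Bool.eq_iff_iff.2 h
  rw [Ap, this, Set.finite_image_iff inj.injOn, E0]

theorem ratSubgroups_eq : ratSubgroups = {A : ℚ → Bool | A 0 = true ∧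
    (∀ x y, A x = true → A y = true → A (x + y) = true) ∧ (∀ x, A x = true → A (-x) = true) ∧
    ∃ x, x ≠ 0 ∧ A x = true} := by
  ext A
  constructor
  · rintro ⟨H, hH, h⟩
    simp only [Set.mem_ofPred_eq, h]
    refine ⟨H.zero_mem, fun x y => H.add_mem, fun x => H.neg_mem, ?_⟩
    obtain ⟨x, hx, h0⟩ := H.bot_or_exists_ne_zero.resolve_left hH
    exact ⟨x, h0, hx⟩
  · rintro ⟨h0, ha, hn, x, hx, hAx⟩
    refine ⟨⟨⟨⟨{q | A q = true}, fun {x y} => ha x y⟩, h0⟩, fun {x} => hn x⟩, ?_, fun q => Iff.rfl⟩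
    intro h
    apply hx
    rw [← AddSubgroup.mem_bot, ← h]
    exact hAx

theorem meas_coord {ι : Type*} (i : ι) : Measurable fun A : ι → Bool => A i = true :=
  measurableSet_setOfPred.1 <| by
    have h : MeasurableSet ((fun A : ι → Bool => A i) ⁻¹' {true}) :=
      measurable_pi_apply i (MeasurableSet.singleton true)
    exact h

theorem meas_ratSubgroups : MeasurableSet ratSubgroups := by
  rw [ratSubgroups_eq]
  apply measurableSet_setOfPred.2
  refine (meas_coord 0).and (Measurable.and ?_ (Measurable.and ?_ ?_))
  · exact Measurable.forall fun x => Measurable.forall fun y =>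
      (meas_coord x).imp ((meas_coord y).imp (meas_coord _))
  · exact Measurable.forall fun x => (meas_coord x).imp (meas_coord _)
  · exact Measurable.exists fun x => measurable_const.and (meas_coord x)

open Classical in
noncomputable def fm (a : ℕ → Bool) : ratSubgroups :=
  ⟨fun q => decide (q ∈ F a), F a, fun h => by
    have := one_mem_F a
    rw [h, AddSubgroup.mem_bot] at this
    exact one_ne_zero this, fun q => by simp⟩

open Classical in
theorem meas_fm : Measurable fm := by
  refine Measurable.subtype_mk (measurable_pi_iff.2 fun q => measurable_to_bool ?_)
  have : ((fun a : ℕ → Bool => decide (q ∈ F a)) ⁻¹' {true}) = {a | ∀ n : ℕ, IsPrimePow n →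
      n ∣ q.den → ∃ i, a i = true ∧ n = Nat.nth Nat.Prime i} := by
    ext a
    simp only [Set.mem_preimage, Set.mem_singleton_iff, decide_eq_true_eq]
    rfl
  rw [this]
  apply measurableSet_setOfPred.2
  exact Measurable.forall fun n => measurable_const.imp (measurable_const.imp
    (Measurable.exists fun i => (meas_coord i).and measurable_const))

def P (A : ℚ → Bool) (m : ℕ) : Prop :=
  m ≠ 0 ∧ A m = true ∧ ∀ k : ℕ, k < m → k ≠ 0 → ¬ (A k = true)

theorem exists_P {A : ℚ → Bool} {H : AddSubgroup ℚ} (hH : H ≠ ⊥)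
    (hA : ∀ q : ℚ, A q = true ↔ q ∈ H) : ∃ m, P A m := by
  classical
  have hex : ∃ m : ℕ, m ≠ 0 ∧ A m = true := by
    obtain ⟨x, hx, h0⟩ := H.bot_or_exists_ne_zero.resolve_left hH
    refine ⟨x.num.natAbs, by simpa using h0, ?_⟩
    rw [hA]
    have h1 : (x.num : ℚ) ∈ H := by
      rw [← Rat.mul_den_eq_num, mul_comm]; exact nmul_mem _ hx
    rcases Int.natAbs_eq x.num with e | e
    · rw [e] at h1; simpa using h1
    · rw [e] at h1; simpa using h1
  have hs := Nat.find_spec hex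
  exact ⟨Nat.find hex, hs.1, hs.2, fun k hk h0 h => Nat.find_min hex hk ⟨h0, h⟩⟩

theorem P_unique {A : ℚ → Bool} {m n : ℕ} (hm : P A m) (hn : P A n) : m = n := by
  rcases lt_trichotomy m n with h | h | h
  · exact absurd hm.2.1 (hn.2.2 m h hm.1)
  · exact h
  · exact absurd hn.2.1 (hm.2.2 n h hn.1)

open Classical in
noncomputable def gm (A : ratSubgroups) (n : ℕ) : Bool :=
  decide (IsPrimePow n ∧ ∃ m : ℕ, P A.1 m ∧ A.1 ((m : ℚ) * (n : ℚ)⁻¹) = true)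

theorem meas_gm : Measurable gm := by
  refine measurable_pi_iff.2 fun n => measurable_to_bool ?_
  have : ((fun A : ratSubgroups => gm A n) ⁻¹' {true}) = Subtype.val ⁻¹' {A : ℚ → Bool |
      IsPrimePow n ∧ ∃ m : ℕ, P A m ∧ A ((m : ℚ) * (n : ℚ)⁻¹) = true} := by
    ext a
    simp [gm]
  rw [this]
  apply measurable_subtype_coe
  apply measurableSet_setOfPred.2
  refine measurable_const.and (Measurable.exists fun m => Measurable.and ?_ (meas_coord _))
  exact measurable_const.and ((meas_coord _).and (Measurable.forall fun k =>
    measurable_const.imp (measurable_const.imp (meas_coord _).not)))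

theorem gm_eq {A : ratSubgroups} {H : AddSubgroup ℚ}
    (hA : ∀ q : ℚ, A.1 q = true ↔ q ∈ H) {m : ℕ} (hm : P A.1 m) (n : ℕ) :
    gm A n = true ↔ n ∈ D (S m H) := by
  simp only [gm, decide_eq_true_eq, D, Set.mem_ofPred_eq, mem_S, hA]
  refine and_congr_right fun _ => ⟨?_, fun h => ⟨m, hm, h⟩⟩
  rintro ⟨k, hk, h⟩
  rwa [P_unique hm hk]

end RatSG

open RatSG in
/-- The isomorphism relation on nonzero additive subgroups of `ℚ` is Borel
bireducible with `E₀`. -/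
theorem ratSubgroup_iso_bireducible_E0 :
    MeasurableSet ratSubgroups ∧
    (∃ f : (ℕ → Bool) → ratSubgroups, Measurable f ∧
      ∀ a b : ℕ → Bool, E0 a b ↔ ratIso (f a).1 (f b).1) ∧
    (∃ g : ratSubgroups → (ℕ → Bool), Measurable g ∧
      ∀ A B : ratSubgroups, ratIso A.1 B.1 ↔ E0 (g A) (g B)) := by
  refine ⟨meas_ratSubgroups, ⟨fm, meas_fm, fun a b => ?_⟩, ⟨gm, meas_gm, fun A B => ?_⟩⟩
  · have hne : F a ≠ ⊥ := fun h => by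
      have := one_mem_F a
      rw [h, AddSubgroup.mem_bot] at this
      exact one_ne_zero this
    rw [ratIso_iff (H := F a) (K := F b) (by simp [fm]) (by simp [fm]), iso_iff hne,
      scale_iff (one_mem_F a) (one_mem_F b), Ap_F]
  · obtain ⟨H, hH, hA⟩ := A.2
    obtain ⟨K, hK, hB⟩ := B.2
    obtain ⟨m, hm⟩ := exists_P hH hA
    obtain ⟨k, hk⟩ := exists_P hK hB
    rw [ratIso_iff hA hB, iso_iff hH, S_iff (h := m) (k := k) (by exact_mod_cast hm.1)
      (by exact_mod_cast hk.1), scale_iff, Ap, E0]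
    · have : {n | ¬ (n ∈ D (S m H) ↔ n ∈ D (S k K))} = {n | gm A n ≠ gm B n} := by
        ext n
        rw [Set.mem_ofPred_eq, Set.mem_ofPred_eq, ← gm_eq hA hm, ← gm_eq hB hk, ne_eq]
        exact not_congr Bool.eq_iff_iff.symm
      rw [this]
    · rw [mem_S, mul_one, ← hA]; exact hm.2.1
    · rw [mem_S, mul_one, ← hB]; exact hk.2.1
end

section
/- (Chao) There exists an uncountable family of real Lie algebras, each of dimension 10 and nilpotent of class 2 (i.e., the derived algebra [L, L] is nonzero and central), which are pairwise non-isomorphic as Lie algebras: there is an uncountable index set S ⊆ ℝ and for each t ∈ S a 10-dimensional nilpotent real Lie algebra L_t of class 2, such that for s ≠ t in S, L_s and L_t are not isomorphic as Lie algebras over ℝ. -/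
set_option linter.unusedSimpArgs false

/-- coordinates 8 and 9 of the bracket -/
def chaoF (t : ℝ) (v w : Fin 10 → ℝ) : Fin 10 → ℝ := fun i =>
  if i = 8 then (v 0 * w 1 - v 1 * w 0) + (v 4 * w 5 - v 5 * w 4) + (v 6 * w 7 - v 7 * w 6)
  else if i = 9 then
    (v 2 * w 3 - v 3 * w 2) + (v 4 * w 5 - v 5 * w 4) + t * (v 6 * w 7 - v 7 * w 6)
  else 0

/-- the bracket -/
def chaoB (t : ℝ) : (Fin 10 → ℝ) →ₗ[ℝ] (Fin 10 → ℝ) →ₗ[ℝ] (Fin 10 → ℝ) :=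
  LinearMap.mk₂ ℝ (chaoF t)
    (by intro a b c; funext i; simp only [chaoF, Pi.add_apply]; split_ifs <;> ring)
    (by intro k b c; funext i; simp only [chaoF, Pi.smul_apply, smul_eq_mul]; split_ifs <;> ring)
    (by intro a b c; funext i; simp only [chaoF, Pi.add_apply]; split_ifs <;> ring)
    (by intro k b c; funext i; simp only [chaoF, Pi.smul_apply, smul_eq_mul]; split_ifs <;> ring)

/-- lying on one of four lines -/
def chaoP (t u v : ℝ) : Prop := v = 0 ∨ u = 0 ∨ u = v ∨ v = t * u

theorem chaoB_8 (t : ℝ) (v w : Fin 10 → ℝ) : chaoB t v w 8 =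
    (v 0 * w 1 - v 1 * w 0) + (v 4 * w 5 - v 5 * w 4) + (v 6 * w 7 - v 7 * w 6) := by
  simp [chaoB, chaoF]

theorem chaoB_9 (t : ℝ) (v w : Fin 10 → ℝ) : chaoB t v w 9 =
    (v 2 * w 3 - v 3 * w 2) + (v 4 * w 5 - v 5 * w 4) + t * (v 6 * w 7 - v 7 * w 6) := by
  simp [chaoB, chaoF]

theorem chaoB_ne (t : ℝ) (v w : Fin 10 → ℝ) (i : Fin 10) (h8 : i ≠ 8) (h9 : i ≠ 9) :
    chaoB t v w i = 0 := by
  simp [chaoB, chaoF, h8, h9]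

theorem chao_line (t : ℝ) (x p : Fin 10 → ℝ)
    (h : ∀ w, chaoB t x w 8 * p 9 = chaoB t x w 9 * p 8)
    (h0 : ∃ w, chaoB t x w = p) : chaoP t (p 8) (p 9) := by
  by_contra hP
  simp only [chaoP, not_or] at hP
  obtain ⟨h1, h2, h3, h4⟩ := hP
  have k0 := h (Pi.single 1 1)
  have k1 := h (Pi.single 0 1)
  have k2 := h (Pi.single 3 1)
  have k3 := h (Pi.single 2 1)
  have k4 := h (Pi.single 5 1)
  have k5 := h (Pi.single 4 1)
  have k6 := h (Pi.single 7 1)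
  have k7 := h (Pi.single 6 1)
  simp [chaoB_8, chaoB_9, Pi.single_apply] at k0 k1 k2 k3 k4 k5 k6 k7
  obtain ⟨w, rfl⟩ := h0
  apply h1
  have e2 : x 2 = 0 := by grind
  have e3 : x 3 = 0 := by grind
  have e4 : x 4 = 0 := by grind
  have e5 : x 5 = 0 := by grind
  have e6 : x 6 = 0 := by grind
  have e7 : x 7 = 0 := by grind
  rw [chaoB_9, e2, e3, e4, e5, e6, e7]; ring

theorem chao_cases (s t a b c d : ℝ) (hs : 2 < s) (ht : 2 < t) (hd : a * d - b * c ≠ 0)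
    (h0 : chaoP t a c) (h1 : chaoP t b d) (h2 : chaoP t (a + b) (c + d))
    (h3 : chaoP t (a + s * b) (c + s * d)) : s = t := by
  have key : (s - t) * (s * t - 1) * (s + t - 1) * (t * (1 - s) - 1) * (t * (s - 1) - s) *
      (t * s - (s - 1)) = 0 := by
    unfold chaoP at *
    rcases h0 with h0 | h0 | h0 | h0 <;> rcases h1 with h1 | h1 | h1 | h1 <;>
      first
      | (exfalso; apply hd; subst_vars; ring; done)
      | (rcases h2 with h2 | h2 | h2 | h2 <;> rcases h3 with h3 | h3 | h3 | h3 <;> grind)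
  have f2 : s * t - 1 ≠ 0 := by apply ne_of_gt; nlinarith
  have f3 : s + t - 1 ≠ 0 := by apply ne_of_gt; linarith
  have f4 : t * (1 - s) - 1 ≠ 0 := by apply ne_of_lt; nlinarith
  have f5 : t * (s - 1) - s ≠ 0 := by apply ne_of_gt; nlinarith
  have f6 : t * s - (s - 1) ≠ 0 := by apply ne_of_gt; nlinarith
  simp only [mul_eq_zero, f2, f3, f4, f5, f6, or_false] at key
  linarith

theorem chao_noiso (s t : ℝ) (hs : 2 < s) (ht : 2 < t) (e : (Fin 10 → ℝ) ≃ₗ[ℝ] (Fin 10 → ℝ))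
    (he : ∀ v w, e (chaoB s v w) = chaoB t (e v) (e w)) : s = t := by
  have key : ∀ x y : Fin 10 → ℝ, (∀ w, ∃ k : ℝ, chaoB s x w = k • chaoB s x y) →
      chaoP t (e (chaoB s x y) 8) (e (chaoB s x y) 9) := by
    intro x y h
    apply chao_line t (e x)
    · intro w
      obtain ⟨w, rfl⟩ := e.surjective w
      obtain ⟨k, hk⟩ := h w
      rw [← he, hk, map_smul]
      simp only [Pi.smul_apply, smul_eq_mul]; ring
    · exact ⟨e y, (he x y).symm⟩
  have z0 : chaoB s (Pi.single 0 1) (Pi.single 1 1) = Pi.single 8 1 := by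
    funext i; fin_cases i <;> simp [chaoB, chaoF, Pi.single_apply]
  have z1 : chaoB s (Pi.single 2 1) (Pi.single 3 1) = Pi.single 9 1 := by
    funext i; fin_cases i <;> simp [chaoB, chaoF, Pi.single_apply]
  have z2 : chaoB s (Pi.single 4 1) (Pi.single 5 1) = Pi.single 8 1 + Pi.single 9 1 := by
    funext i; fin_cases i <;> simp [chaoB, chaoF, Pi.single_apply]
  have z3 : chaoB s (Pi.single 6 1) (Pi.single 7 1) = Pi.single 8 1 + s • Pi.single 9 1 := by
    funext i; fin_cases i <;> simp [chaoB, chaoF, Pi.single_apply]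
  have p0 := key (Pi.single 0 1) (Pi.single 1 1) (fun w => ⟨w 1, by
    funext i; fin_cases i <;> simp [chaoB, chaoF, Pi.single_apply]⟩)
  have p1 := key (Pi.single 2 1) (Pi.single 3 1) (fun w => ⟨w 3, by
    funext i; fin_cases i <;> simp [chaoB, chaoF, Pi.single_apply]⟩)
  have p2 := key (Pi.single 4 1) (Pi.single 5 1) (fun w => ⟨w 5, by
    funext i; fin_cases i <;> simp [chaoB, chaoF, Pi.single_apply]⟩)
  have p3 := key (Pi.single 6 1) (Pi.single 7 1) (fun w => ⟨w 7, by
    funext i; fin_cases i <;> simp [chaoB, chaoF, Pi.single_apply, mul_comm]⟩)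
  have c0 : ∀ i, i ≠ 8 → i ≠ 9 → e (Pi.single 8 1) i = 0 := by
    intro i h8 h9; rw [← z0, he]; exact chaoB_ne _ _ _ _ h8 h9
  have c1 : ∀ i, i ≠ 8 → i ≠ 9 → e (Pi.single 9 1) i = 0 := by
    intro i h8 h9; rw [← z1, he]; exact chaoB_ne _ _ _ _ h8 h9
  rw [z0] at p0
  rw [z1] at p1
  rw [z2, map_add] at p2
  rw [z3, map_add, map_smul] at p3
  simp only [Pi.add_apply, Pi.smul_apply, smul_eq_mul] at p2 p3
  refine chao_cases s t _ _ _ _ hs ht ?_ p0 p1 p2 p3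
  intro hdet
  have lin : ∀ k l : ℝ, k * e (Pi.single 8 1) 8 + l * e (Pi.single 9 1) 8 = 0 →
      k * e (Pi.single 8 1) 9 + l * e (Pi.single 9 1) 9 = 0 → k = 0 ∧ l = 0 := by
    intro k l h8 h9
    have hz : e (k • Pi.single 8 1 + l • Pi.single 9 1) = 0 := by
      rw [map_add, map_smul, map_smul]
      funext i
      by_cases i8 : i = 8
      · subst i8; simpa using h8
      by_cases i9 : i = 9
      · subst i9; simpa using h9
      simp [c0 i i8 i9, c1 i i8 i9]
    rw [LinearEquiv.map_eq_zero_iff] at hz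
    have q8 := congrFun hz 8
    have q9 := congrFun hz 9
    simp [Pi.single_apply] at q8 q9
    exact ⟨q8, q9⟩
  have l1 := lin (e (Pi.single 9 1) 9) (-e (Pi.single 8 1) 9) (by linarith) (by ring)
  have l2 := lin (e (Pi.single 9 1) 8) (-e (Pi.single 8 1) 8) (by ring) (by linarith)
  have l3 := lin 1 0 (by linarith [l2.2]) (by linarith [l1.2])
  exact one_ne_zero l3.1

theorem chaoB_zero (t : ℝ) (u v w : Fin 10 → ℝ) : chaoB t (chaoB t u v) w = 0 := by
  have h := chaoB_ne t u v
  funext i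
  simp [chaoB.eq_1 t, chaoF]

/-- Chao: there is an uncountable family, indexed by an uncountable set of reals,
of pairwise non-isomorphic 10-dimensional real nilpotent Lie algebras of class 2.
Each algebra is given by a Lie bracket (an antisymmetric bilinear map satisfying
the Jacobi identity) on the 10-dimensional real vector space `Fin 10 → ℝ`, it is
of class 2 in the sense that the derived algebra is nonzero while `[[L,L],L] = 0`,
and no bijective linear map intertwines the brackets of two distinct members. -/
theorem chao_uncountably_many_nilpotent_lie_algebras :
    ∃ S : Set ℝ, ¬ S.Countable ∧
      ∃ B : S → (Fin 10 → ℝ) →ₗ[ℝ] (Fin 10 → ℝ) →ₗ[ℝ] (Fin 10 → ℝ),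
        (∀ t : S, ∀ v w : Fin 10 → ℝ, B t v w = - B t w v) ∧
        (∀ t : S, ∀ u v w : Fin 10 → ℝ,
          B t (B t u v) w + B t (B t v w) u + B t (B t w u) v = 0) ∧
        (∀ t : S, ∃ v w : Fin 10 → ℝ, B t v w ≠ 0) ∧
        (∀ t : S, ∀ u v w : Fin 10 → ℝ, B t (B t u v) w = 0) ∧
        (∀ s t : S, s ≠ t →
          ¬ ∃ e : (Fin 10 → ℝ) ≃ₗ[ℝ] (Fin 10 → ℝ),
            ∀ v w : Fin 10 → ℝ, e (B s v w) = B t (e v) (e w)) := by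
  refine ⟨Set.Ioi 2, ?_, fun t => chaoB t, ?_, ?_, ?_, ?_, ?_⟩
  · rw [← Cardinal.le_aleph0_iff_set_countable, Cardinal.mk_Ioi_real, not_le]
    exact Cardinal.aleph0_lt_continuum
  · intro t v w
    funext i; simp only [chaoB, LinearMap.mk₂_apply, chaoF, Pi.neg_apply]; split_ifs <;> ring
  · intro t u v w
    simp only [chaoB_zero, add_zero]
  · intro t
    refine ⟨Pi.single 0 1, Pi.single 1 1, fun h => ?_⟩
    have := congrFun h 8
    simp [chaoB_8, Pi.single_apply] at this
  · intro t u v w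
    exact chaoB_zero _ _ _ _
  · rintro s t hst ⟨e, he⟩
    exact hst (Subtype.ext (chao_noiso s t s.2 t.2 e he))
end
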